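/- Let (k_i)_{i≥1} be a sequence of positive integers satisfying condition (★) which is bounded and such that the sets {i : k_{2i} > 1} and {i : k_{2i-1} > 1} have bounded gaps (so that the subshift (X,σ) is linearly recurrent and in particular uniquely ergodic; let μ be its unique σ-invariant Borel probability measure). Then: (a) (X,σ,μ) is weakly mixing (every μ-measurable f : X → ℂ not μ-a.e. 0 with f∘σ = c·f μ-a.e. for some c ∈ ℂ is constant μ-a.e.) if and only if for every ξ ∈ (0,1) there is no z ∈ ℤ³ with ((ξ,ξ,ξ) − z)·A_{k_1}A_{k_2}⋯A_{k_n} → 0 as n → ∞; and (b) for every ξ ∈ (0,1), if there exists a μ-measurable f : X → ℂ, not μ-a.e. 0, with f∘σ = e^{2πiξ}·f μ-a.e., then there exists a continuous f : X → ℂ, not identically zero, with f(σ(x)) = e^{2πiξ} f(x) for all x ∈ X (every measurable eigenvalue is continuous). -/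

import Mathlib

open Filter Topology MeasureTheory

/-- The substitution `χ_k` on the alphabet `{1,2,3}`, coded as `Fin 3 = {0,1,2}`
(letter 1 ↦ 0, letter 2 ↦ 1, letter 3 ↦ 2):
`χ_k(1) = 2`, `χ_k(2) = 3 1^k`, `χ_k(3) = 3 1^(k-1)`. -/
def chiSub (k : ℕ) : Fin 3 → List (Fin 3) :=
  ![[1], 2 :: List.replicate k 0, 2 :: List.replicate (k - 1) 0]

/-- Extension of `χ_k` to finite words by concatenation. -/
def applyChi (k : ℕ) (w : List (Fin 3)) : List (Fin 3) := w.flatMap (chiSub k)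

/-- `compApply k n w = χ_{k 1} ∘ χ_{k 2} ∘ ⋯ ∘ χ_{k n} (w)`. -/
def compApply (k : ℕ → ℕ) : ℕ → List (Fin 3) → List (Fin 3)
  | 0, w => w
  | n + 1, w => compApply k n (applyChi (k (n + 1)) w)

/-- Condition (★): k_{2i} > 1` for infinitely many `i` and `k_{2i-1} > 1`
for infinitely many `i`. -/
def StarCond (k : ℕ → ℕ) : Prop :=
  (∀ N, ∃ i ≥ N, 1 < k (2 * i)) ∧ (∀ N, ∃ i ≥ N, 1 < k (2 * i - 1))

/-- `w` is a prefix of the infinite sequence `x`. -/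
def IsPrefixSeq (w : List (Fin 3)) (x : ℕ → Fin 3) : Prop :=
  w = List.ofFn fun i : Fin w.length => x i

/-- The left shift `σ`. -/
def shift (x : ℕ → Fin 3) : ℕ → Fin 3 := fun i => x (i + 1)

/-- The closure of the `σ`-orbit of `ρ`: the subshift `X`. -/
def orbitClosure (ρ : ℕ → Fin 3) : Set (ℕ → Fin 3) :=
  closure {y | ∃ n : ℕ, y = fun i => ρ (i + n)}

/-- The matrix `A_k` with real entries, rows `(0,k,k-1)`, `(1,0,0)`, `(0,1,1)`. -/
noncomputable def Amat (k : ℕ) : Matrix (Fin 3) (Fin 3) ℝ :=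
  !![0, (k : ℝ), (k : ℝ) - 1; 1, 0, 0; 0, 1, 1]

/-- `Aprod k n = A_{k_1} A_{k_2} ⋯ A_{k_n}`. -/
noncomputable def Aprod (k : ℕ → ℕ) (n : ℕ) : Matrix (Fin 3) (Fin 3) ℝ :=
  ((List.range n).map fun i => Amat (k (i + 1))).prod

/-- `(ξ,ξ,ξ)` belongs to the stable space `W^s(0) mod 1`: for some integer vector `z`,
the row vectors `((ξ,ξ,ξ) − z) · A_{k_1} ⋯ A_{k_n}` tend to `0`. -/
def InStableMod1 (k : ℕ → ℕ) (ξ : ℝ) : Prop :=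
  ∃ z : Fin 3 → ℤ,
    Tendsto (fun n => Matrix.vecMul (fun i => ξ - (z i : ℝ)) (Aprod k n)) atTop (nhds 0)

/-- `c` is a continuous eigenvalue of the subshift `X`: there is a continuous function
`f` on `X`, not identically zero on `X`, with `f ∘ σ = c·f` on `X`. -/
def IsCtsEigenvalue (X : Set (ℕ → Fin 3)) (c : ℂ) : Prop :=
  ∃ f : (ℕ → Fin 3) → ℂ, ContinuousOn f X ∧ (∃ x ∈ X, f x ≠ 0) ∧
    ∀ x ∈ X, f (shift x) = c * f x

/-- A `σ`-invariant Borel probability measure on `X`, encoded as a measure on the full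
product space giving `X` full mass. -/
def IsInvProb (X : Set (ℕ → Fin 3)) (μ : Measure (ℕ → Fin 3)) : Prop :=
  IsProbabilityMeasure μ ∧ μ Xᶜ = 0 ∧ μ.map shift = μ

/-- Weak mixing of `(X,σ,μ)`: every `μ`-measurable `f`, not `μ`-a.e. `0`, satisfying
`f ∘ σ = c·f` `μ`-a.e. for some `c ∈ ℂ`, is constant `μ`-a.e. -/
def WeaklyMixing (μ : Measure (ℕ → Fin 3)) : Prop :=
  ∀ (f : (ℕ → Fin 3) → ℂ) (c : ℂ), AEMeasurable f μ → ¬ f =ᵐ[μ] 0 →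
    (fun x => f (shift x)) =ᵐ[μ] (fun x => c * f x) →
    ∃ d : ℂ, f =ᵐ[μ] fun _ => d

/-! ### Words and their images -/

/-- The sequence `k` with its first `n` terms dropped. -/
def dropSeq (k : ℕ → ℕ) (n : ℕ) : ℕ → ℕ := fun i => k (n + i)

/-- The prefix of length `m` of an infinite sequence. -/
def pre (x : ℕ → Fin 3) (m : ℕ) : List (Fin 3) := (List.range m).map x

@[simp] lemma length_pre (x : ℕ → Fin 3) (m : ℕ) : (pre x m).length = m := by simp [pre]

lemma pre_succ (x : ℕ → Fin 3) (m : ℕ) : pre x (m + 1) = pre x m ++ [x m] := by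
  simp [pre, List.range_succ]

lemma isPrefixSeq_iff {w : List (Fin 3)} {x : ℕ → Fin 3} :
    IsPrefixSeq w x ↔ w = pre x w.length := by
  unfold IsPrefixSeq pre
  rw [show (List.ofFn fun i : Fin w.length => x i) = (List.range w.length).map x by
    apply List.ext_getElem <;> simp]

lemma IsPrefixSeq.getElem {w : List (Fin 3)} {x : ℕ → Fin 3} (h : IsPrefixSeq w x) {i : ℕ}
    (hi : i < w.length) : w[i] = x i := by
  rw [isPrefixSeq_iff] at h
  rw [List.getElem_of_eq h hi]
  simp [pre]

lemma isPrefixSeq_of_getElem {w : List (Fin 3)} {x : ℕ → Fin 3}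
    (h : ∀ i (hi : i < w.length), w[i] = x i) : IsPrefixSeq w x := by
  rw [isPrefixSeq_iff]
  apply List.ext_getElem
  · simp
  · intro i h1 h2
    rw [h i h1]
    simp [pre]

lemma IsPrefixSeq.of_isPrefix {u w : List (Fin 3)} {x : ℕ → Fin 3} (h : IsPrefixSeq w x)
    (hu : u <+: w) : IsPrefixSeq u x := by
  refine isPrefixSeq_of_getElem fun i hi => ?_
  rw [← h.getElem (hi.trans_le hu.length_le)]
  exact hu.getElem hi

lemma isPrefixSeq_pre (x : ℕ → Fin 3) (m : ℕ) : IsPrefixSeq (pre x m) x := by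
  simp [isPrefixSeq_iff]

lemma pre_isPrefix {w : List (Fin 3)} {x : ℕ → Fin 3} (h : IsPrefixSeq w x) {m : ℕ}
    (hm : m ≤ w.length) : pre x m <+: w := by
  rw [isPrefixSeq_iff] at h
  rw [h]
  refine ⟨(List.range' m (w.length - m)).map x, ?_⟩
  simp only [pre, ← List.map_append, List.range_eq_range']
  congr 1
  have := List.range'_append (s := 0) (m := m) (n := w.length - m) (step := 1)
  simp only [zero_add, one_mul] at this
  rw [this]
  congr 1
  omega

lemma isPrefixSeq_append_singleton {u : List (Fin 3)} {x : ℕ → Fin 3} {v : List (Fin 3)}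
    (h : IsPrefixSeq (u ++ v) x) {i : ℕ} (hi : i < v.length) : x (u.length + i) = v[i] := by
  rw [← h.getElem (by simpa using hi)]
  simp

lemma applyChi_append (k : ℕ) (u v : List (Fin 3)) :
    applyChi k (u ++ v) = applyChi k u ++ applyChi k v := by simp [applyChi]

lemma compApply_append (k : ℕ → ℕ) (n : ℕ) (u v : List (Fin 3)) :
    compApply k n (u ++ v) = compApply k n u ++ compApply k n v := by
  induction n generalizing u v with
  | zero => rfl
  | succ n ih => simp only [compApply, applyChi_append, ih]

lemma compApply_nil (k : ℕ → ℕ) (n : ℕ) : compApply k n [] = [] := by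
  induction n with
  | zero => rfl
  | succ n ih => simpa [compApply, applyChi] using ih

lemma compApply_add (k : ℕ → ℕ) (n m : ℕ) (w : List (Fin 3)) :
    compApply k (n + m) w = compApply k n (compApply (dropSeq k n) m w) := by
  induction m generalizing w with
  | zero => rfl
  | succ m ih =>
    change compApply k (n + m) _ = _
    rw [ih]
    rfl

lemma compApply_isPrefix (k : ℕ → ℕ) (n : ℕ) {u v : List (Fin 3)} (h : u <+: v) :
    compApply k n u <+: compApply k n v := by
  obtain ⟨t, rfl⟩ := h
  rw [compApply_append]
  exact List.prefix_append _ _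

lemma mem_compApply (k : ℕ → ℕ) (n : ℕ) {w : List (Fin 3)} {a b : Fin 3} (hb : b ∈ w)
    (ha : a ∈ compApply k n [b]) : a ∈ compApply k n w := by
  obtain ⟨s, t, rfl⟩ := List.append_of_mem hb
  rw [← List.singleton_append, compApply_append, compApply_append]
  simp [ha]

/-- The height `|χ_{k 1} ∘ ⋯ ∘ χ_{k n} (j)|`. -/
def hgt (k : ℕ → ℕ) (n : ℕ) (j : Fin 3) : ℕ := (compApply k n [j]).length

lemma length_compApply (k : ℕ → ℕ) (n : ℕ) (w : List (Fin 3)) :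
    (compApply k n w).length = (w.map (hgt k n)).sum := by
  induction w with
  | nil => simp [compApply_nil]
  | cons a w ih =>
    rw [← List.singleton_append, compApply_append]
    simp [ih, hgt]

/-- The hypotheses on `(k_i)`, in a form invariant under dropping terms. -/
structure GoodSeq (k : ℕ → ℕ) (B N : ℕ) : Prop where
  pos : ∀ i, 1 ≤ i → 1 ≤ k i
  le : ∀ i, 1 ≤ i → k i ≤ B
  gap : ∀ i, 1 ≤ i → ∃ l ≤ N, 1 < k (i + 2 * l)

lemma GoodSeq.dropSeq {k : ℕ → ℕ} {B N : ℕ} (h : GoodSeq k B N) (n : ℕ) :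
    GoodSeq (dropSeq k n) B N where
  pos i hi := h.pos _ (by omega)
  le i hi := h.le _ (by omega)
  gap i hi := by
    obtain ⟨l, hl, h1⟩ := h.gap (n + i) (by omega)
    exact ⟨l, hl, by simpa [_root_.dropSeq, add_assoc] using h1⟩

lemma chiSub_one (k : ℕ) : chiSub k 1 = 2 :: List.replicate k 0 := rfl
lemma chiSub_two (k : ℕ) : chiSub k 2 = 2 :: List.replicate (k - 1) 0 := rfl
lemma applyChi_singleton (k : ℕ) (j : Fin 3) : applyChi k [j] = chiSub k j := by simp [applyChi]

lemma two_mem_compApply (k : ℕ → ℕ) (n : ℕ) : (2 : Fin 3) ∈ compApply k n [2] := by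
  induction n with
  | zero => simp [compApply]
  | succ n ih =>
    refine mem_compApply k n (b := 2) ?_ ih
    simp [applyChi, chiSub]

lemma zero_mem_compApply_two {k : ℕ → ℕ} (hk : ∀ i, 1 ≤ i → 1 ≤ k i) (n : ℕ) {w : List (Fin 3)}
    (hw : 0 ∈ w) : 0 ∈ compApply k (2 * n) w := by
  induction n generalizing w with
  | zero => simpa [compApply] using hw
  | succ n ih =>
    refine ih (w := applyChi (k (2 * n + 1)) (applyChi (k (2 * n + 2)) w)) ?_
    have h1 := hk (2 * n + 1) (by omega)
    rw [applyChi, List.mem_flatMap]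
    refine ⟨1, ?_, ?_⟩
    · rw [applyChi, List.mem_flatMap]
      exact ⟨0, hw, by simp [chiSub]⟩
    · rw [chiSub_one]
      simp
      omega

lemma one_mem_compApply_two {k : ℕ → ℕ} (hk : ∀ i, 1 ≤ i → 1 ≤ k i) (n : ℕ) {w : List (Fin 3)}
    (hw : 0 ∈ w) : 1 ∈ compApply k (2 * n + 1) w := by
  rw [add_comm, compApply_add]
  have := zero_mem_compApply_two (k := dropSeq k 1) (fun i hi => hk _ (by omega)) n hw
  exact mem_compApply k 1 this (by simp [compApply, applyChi, chiSub])

lemma two_mem_compApply_two_steps (k : ℕ → ℕ) (j : Fin 3) : (2 : Fin 3) ∈ compApply k 2 [j] := by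
  fin_cases j <;> simp [compApply, applyChi, chiSub]

lemma mem_applyChi_zero {k : ℕ} (hk : 1 < k) {w : List (Fin 3)} (hw : 2 ∈ w) :
    0 ∈ applyChi k w := by
  rw [applyChi, List.mem_flatMap]
  refine ⟨2, hw, ?_⟩
  rw [chiSub_two]
  simp
  omega

lemma two_mem_of_two_le (k : ℕ → ℕ) {n : ℕ} (hn : 2 ≤ n) (j : Fin 3) :
    (2 : Fin 3) ∈ compApply k n [j] := by
  obtain ⟨m, rfl⟩ := Nat.exists_eq_add_of_le hn
  rw [add_comm, compApply_add]
  exact mem_compApply k m (two_mem_compApply_two_steps _ j) (two_mem_compApply _ _)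

/-- After `2 * N + 4` steps every letter occurs in the image of every letter. -/
lemma GoodSeq.mem_compApply {k : ℕ → ℕ} {B N : ℕ} (h : GoodSeq k B N) (a j : Fin 3) :
    a ∈ compApply k (2 * N + 4) [j] := by
  have key : ∀ i, 1 ≤ i → i ≤ 2 → ∃ l, l ≤ N ∧
      (0 : Fin 3) ∈ compApply (_root_.dropSeq k (i + 2 * l - 1)) (2 * N + 4 - (i + 2 * l - 1)) [j] := by
    intro i hi1 hi2
    obtain ⟨l, hl, hk⟩ := h.gap i hi1
    refine ⟨l, hl, ?_⟩
    have e : 2 * N + 4 - (i + 2 * l - 1) = 1 + (2 * N + 4 - (i + 2 * l)) := by omega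
    rw [e, compApply_add]
    change (0 : Fin 3) ∈ applyChi (k (i + 2 * l - 1 + 1)) _
    rw [Nat.sub_add_cancel (by omega)]
    exact mem_applyChi_zero hk (two_mem_of_two_le _ (by omega) j)
  have split : ∀ m ≤ 2 * N + 4, compApply k (2 * N + 4) [j]
      = compApply k m (compApply (_root_.dropSeq k m) (2 * N + 4 - m) [j]) := by
    intro m hm
    rw [← compApply_add, Nat.add_sub_cancel' hm]
  have h0 : a = 0 ∨ a = 1 ∨ a = 2 := by fin_cases a <;> simp
  rcases h0 with rfl | rfl | rfl
  · obtain ⟨l, hl, h0⟩ := key 1 le_rfl (by omega)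
    rw [split (1 + 2 * l - 1) (by omega)]
    have : 1 + 2 * l - 1 = 2 * l := by omega
    rw [this] at h0 ⊢
    exact zero_mem_compApply_two h.pos l h0
  · obtain ⟨l, hl, h0⟩ := key 2 (by omega) le_rfl
    rw [split (2 + 2 * l - 1) (by omega)]
    have : 2 + 2 * l - 1 = 2 * l + 1 := by omega
    rw [this] at h0 ⊢
    exact one_mem_compApply_two h.pos l h0
  · exact two_mem_of_two_le k (by omega) j

/-! ### Heights -/

lemma compApply_ne_nil (k : ℕ → ℕ) (n : ℕ) {w : List (Fin 3)} (hw : w ≠ []) :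
    compApply k n w ≠ [] := by
  induction n generalizing w with
  | zero => exact hw
  | succ n ih =>
    refine ih ?_
    obtain ⟨a, w, rfl⟩ := List.exists_cons_of_ne_nil hw
    simp only [applyChi, List.flatMap_cons, ne_eq, List.append_eq_nil_iff, not_and]
    intro h
    fin_cases a <;> simp [chiSub] at h

lemma hgt_pos (k : ℕ → ℕ) (n : ℕ) (j : Fin 3) : 1 ≤ hgt k n j :=
  List.length_pos_of_ne_nil (compApply_ne_nil k n (by simp))

/-- The sum of the three heights at level `n`. -/
def totalHgt (k : ℕ → ℕ) (n : ℕ) : ℕ := ∑ j, hgt k n j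

lemma hgt_le_total (k : ℕ → ℕ) (n : ℕ) (j : Fin 3) : hgt k n j ≤ totalHgt k n :=
  Finset.single_le_sum (f := hgt k n) (fun _ _ => Nat.zero_le _) (Finset.mem_univ j)

lemma hgt_add (k : ℕ → ℕ) (n m : ℕ) (j : Fin 3) :
    hgt k (n + m) j = ((compApply (dropSeq k n) m [j]).map (hgt k n)).sum := by
  rw [hgt, compApply_add, length_compApply]

lemma hgt_succ_zero (k : ℕ → ℕ) (n : ℕ) : hgt k (n + 1) 0 = hgt k n 1 := by
  rw [hgt_add]; simp [compApply, applyChi, chiSub]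

lemma hgt_succ_one (k : ℕ → ℕ) (n : ℕ) :
    hgt k (n + 1) 1 = hgt k n 2 + k (n + 1) * hgt k n 0 := by
  rw [hgt_add]; simp [compApply, applyChi, chiSub, dropSeq]

lemma hgt_succ_two (k : ℕ → ℕ) (n : ℕ) :
    hgt k (n + 1) 2 = hgt k n 2 + (k (n + 1) - 1) * hgt k n 0 := by
  rw [hgt_add]; simp [compApply, applyChi, chiSub, dropSeq]

lemma totalHgt_eq (k : ℕ → ℕ) (n : ℕ) : totalHgt k n = hgt k n 0 + hgt k n 1 + hgt k n 2 := by
  simp [totalHgt, Fin.sum_univ_three]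

lemma totalHgt_le_sum {k : ℕ → ℕ} (n : ℕ) {w : List (Fin 3)} (hw : ∀ a, a ∈ w) :
    totalHgt k n ≤ (w.map (hgt k n)).sum := by
  rw [Finset.sum_list_map_count]
  simp only [smul_eq_mul]
  rw [show w.toFinset = Finset.univ by ext a; simp [hw a]]
  refine Finset.sum_le_sum fun a _ => ?_
  have := List.count_pos_iff.2 (hw a)
  nlinarith

lemma GoodSeq.total_le_hgt {k : ℕ → ℕ} {B N : ℕ} (h : GoodSeq k B N) (n : ℕ) (j : Fin 3) :
    totalHgt k n ≤ hgt k (n + (2 * N + 4)) j := by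
  rw [hgt_add]
  exact totalHgt_le_sum n fun a => (h.dropSeq n).mem_compApply a j

lemma GoodSeq.total_succ_le {k : ℕ → ℕ} {B N : ℕ} (h : GoodSeq k B N) (n : ℕ) :
    totalHgt k (n + 1) ≤ (2 * B + 2) * totalHgt k n := by
  have hk := h.le (n + 1) (by omega)
  rw [totalHgt_eq, totalHgt_eq, hgt_succ_zero, hgt_succ_one, hgt_succ_two]
  have h1 : k (n + 1) * hgt k n 0 ≤ B * hgt k n 0 := Nat.mul_le_mul_right _ hk
  have h2 : (k (n + 1) - 1) * hgt k n 0 ≤ B * hgt k n 0 := Nat.mul_le_mul_right _ (by omega)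
  nlinarith [Nat.zero_le (B * hgt k n 1), Nat.zero_le (B * hgt k n 2)]

lemma GoodSeq.total_add_le {k : ℕ → ℕ} {B N : ℕ} (h : GoodSeq k B N) (n m : ℕ) :
    totalHgt k (n + m) ≤ (2 * B + 2) ^ m * totalHgt k n := by
  induction m with
  | zero => simp
  | succ m ih =>
    calc _ ≤ (2 * B + 2) * totalHgt k (n + m) := h.total_succ_le (n + m)
      _ ≤ (2 * B + 2) * ((2 * B + 2) ^ m * totalHgt k n) := Nat.mul_le_mul_left _ ih
      _ = _ := by ring

lemma GoodSeq.exists_total_le_mul_hgt {k : ℕ → ℕ} {B N : ℕ} (h : GoodSeq k B N) :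
    ∃ D : ℕ, 0 < D ∧ ∀ n j, totalHgt k n ≤ D * hgt k n j := by
  refine ⟨3 * (2 * B + 2) ^ (2 * N + 4), by positivity, fun n j => ?_⟩
  have hj := hgt_pos k n j
  rcases le_or_gt (2 * N + 4) n with hn | hn
  · obtain ⟨m, rfl⟩ := Nat.exists_eq_add_of_le' hn
    calc _ ≤ _ := h.total_add_le m (2 * N + 4)
      _ ≤ (2 * B + 2) ^ (2 * N + 4) * hgt k (m + (2 * N + 4)) j :=
        Nat.mul_le_mul_left _ (h.total_le_hgt m j)
      _ ≤ _ := Nat.mul_le_mul_right _ (by omega)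
  · have h0 : totalHgt k 0 = 3 := by simp [totalHgt, hgt, compApply]
    calc totalHgt k n ≤ (2 * B + 2) ^ n * totalHgt k 0 := by simpa using h.total_add_le 0 n
      _ ≤ (2 * B + 2) ^ (2 * N + 4) * 3 := by
        rw [h0]
        exact Nat.mul_le_mul_right _ (Nat.pow_le_pow_right (by omega) hn.le)
      _ = 3 * (2 * B + 2) ^ (2 * N + 4) * 1 := by ring
      _ ≤ _ := Nat.mul_le_mul_left _ hj

lemma GoodSeq.hgt_large {k : ℕ → ℕ} {B N : ℕ} (h : GoodSeq k B N) (K : ℕ) :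
    ∃ n₀, ∀ n ≥ n₀, ∀ j, K ≤ hgt k n j := by
  induction K with
  | zero => exact ⟨0, fun _ _ _ => Nat.zero_le _⟩
  | succ K ih =>
    obtain ⟨n₀, hn₀⟩ := ih
    refine ⟨n₀ + (2 * N + 4), fun n hn j => ?_⟩
    obtain ⟨m, rfl⟩ : ∃ m, n = m + (2 * N + 4) := ⟨n - (2 * N + 4), by omega⟩
    refine le_trans ?_ (h.total_le_hgt m j)
    rw [totalHgt_eq]
    have := hn₀ m (by omega) 0
    have := hgt_pos k m 1
    omega

/-! ### Towers of desubstituted sequences -/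

/-- `c (n+1)` is a preimage of `c n` under `χ_{k (n+1)}`, for every `n`. -/
def IsTower (k : ℕ → ℕ) (c : ℕ → ℕ → Fin 3) : Prop :=
  ∀ n m, IsPrefixSeq (applyChi (k (n + 1)) (pre (c (n + 1)) m)) (c n)

/-- The position in `c 0` of the `q`-th block of level `n`. -/
def cut (k : ℕ → ℕ) (c : ℕ → ℕ → Fin 3) (n q : ℕ) : ℕ := (compApply k n (pre (c n) q)).length

lemma IsTower.drop {k : ℕ → ℕ} {c : ℕ → ℕ → Fin 3} (h : IsTower k c) (n : ℕ) :
    IsTower (dropSeq k n) (fun i => c (n + i)) := fun i m => h (n + i) m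

@[simp] lemma cut_zero_right (k : ℕ → ℕ) (c : ℕ → ℕ → Fin 3) (n : ℕ) : cut k c n 0 = 0 := by
  simp [cut, pre, compApply_nil]

@[simp] lemma cut_zero_left (k : ℕ → ℕ) (c : ℕ → ℕ → Fin 3) (q : ℕ) : cut k c 0 q = q := by
  simp [cut, compApply]

lemma cut_succ (k : ℕ → ℕ) (c : ℕ → ℕ → Fin 3) (n q : ℕ) :
    cut k c n (q + 1) = cut k c n q + hgt k n (c n q) := by
  simp [cut, pre_succ, compApply_append, hgt]

lemma cut_strictMono (k : ℕ → ℕ) (c : ℕ → ℕ → Fin 3) (n : ℕ) : StrictMono (cut k c n) :=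
  strictMono_nat_of_lt_succ fun q => by
    rw [cut_succ]
    have := hgt_pos k n (c n q)
    omega

lemma compApply_pre_isPrefixSeq {k : ℕ → ℕ} {c : ℕ → ℕ → Fin 3} (h : IsTower k c) (n m : ℕ) :
    IsPrefixSeq (compApply k n (pre (c n) m)) (c 0) := by
  induction n generalizing m with
  | zero => exact isPrefixSeq_pre _ _
  | succ n ih =>
    change IsPrefixSeq (compApply k n _) _
    rw [isPrefixSeq_iff.1 (h n m)]
    exact ih _

lemma IsTower.block {k : ℕ → ℕ} {c : ℕ → ℕ → Fin 3} (h : IsTower k c) (n q : ℕ) {i : ℕ}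
    (hi : i < (compApply k n [c n q]).length) :
    c 0 (cut k c n q + i) = (compApply k n [c n q])[i] := by
  have := compApply_pre_isPrefixSeq h n (q + 1)
  rw [pre_succ, compApply_append] at this
  exact isPrefixSeq_append_singleton this hi

lemma IsTower.cut_add {k : ℕ → ℕ} {c : ℕ → ℕ → Fin 3} (h : IsTower k c) (n m q : ℕ) :
    cut k c (n + m) q = cut k c n (cut (dropSeq k n) (fun i => c (n + i)) m q) := by
  have := compApply_pre_isPrefixSeq (h.drop n) m q
  rw [isPrefixSeq_iff] at this
  rw [cut, compApply_add, cut, cut]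
  simp only [add_zero] at this
  rw [← this]

lemma cut_succ_le (k : ℕ → ℕ) (c : ℕ → ℕ → Fin 3) (n q : ℕ) :
    cut k c n (q + 1) ≤ cut k c n q + totalHgt k n := by
  rw [cut_succ]
  have := hgt_le_total k n (c n q)
  omega

lemma exists_cut_ge (k : ℕ → ℕ) (c : ℕ → ℕ → Fin 3) (n p : ℕ) :
    ∃ q, p ≤ cut k c n q ∧ cut k c n q ≤ p + totalHgt k n := by
  induction p with
  | zero => exact ⟨0, by simp⟩
  | succ p ih =>
    obtain ⟨q, h1, h2⟩ := ih
    rcases h1.lt_or_eq with h1 | h1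
    · exact ⟨q, h1, by omega⟩
    · refine ⟨q + 1, ?_, ?_⟩
      · have := cut_strictMono k c n (Nat.lt_add_one q)
        omega
      · have := cut_succ_le k c n q
        omega

/-- The block `q` of level `n+(2 * N + 4)` contains a block of level `n` of every type. -/
lemma IsTower.exists_sub_block {k : ℕ → ℕ} {c : ℕ → ℕ → Fin 3} {B N : ℕ} (hg : GoodSeq k B N)
    (h : IsTower k c) (n q : ℕ) (a : Fin 3) :
    ∃ r, c n r = a ∧ cut (dropSeq k n) (fun i => c (n + i)) (2 * N + 4) q ≤ r ∧
      r < cut (dropSeq k n) (fun i => c (n + i)) (2 * N + 4) (q + 1) := by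
  have ha := (hg.dropSeq n).mem_compApply a (c (n + (2 * N + 4)) q)
  obtain ⟨i, hi, hia⟩ := List.getElem_of_mem ha
  refine ⟨cut (dropSeq k n) (fun i => c (n + i)) (2 * N + 4) q + i, ?_, by omega, ?_⟩
  · have := (h.drop n).block (2 * N + 4) q hi
    simp only [add_zero] at this
    rw [this, hia]
  · rw [cut_succ]
    exact Nat.add_lt_add_left hi _

/-- Blocks of every type of level `n` occur with gaps of the order of the heights. -/
lemma IsTower.exists_block_ge {k : ℕ → ℕ} {c : ℕ → ℕ → Fin 3} {B N : ℕ} (hg : GoodSeq k B N)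
    (h : IsTower k c) (n p : ℕ) (a : Fin 3) :
    ∃ r, c n r = a ∧ p ≤ cut k c n r ∧
      cut k c n (r + 1) ≤ p + 2 * totalHgt k (n + (2 * N + 4)) := by
  obtain ⟨q, h1, h2⟩ := exists_cut_ge k c (n + (2 * N + 4)) p
  obtain ⟨r, ha, h3, h4⟩ := h.exists_sub_block hg n q a
  refine ⟨r, ha, ?_, ?_⟩
  · rw [h.cut_add] at h1
    exact h1.trans ((cut_strictMono k c n).monotone h3)
  · have h5 := (cut_strictMono k c n).monotone (Nat.succ_le_of_lt h4)
    rw [← h.cut_add] at h5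
    have := cut_succ_le k c (n + (2 * N + 4)) q
    simp only [Nat.succ_eq_add_one] at h5
    omega

/-- Two blocks of level `n+2` have a common prefix of length `hgt k n 2`. -/
lemma IsTower.agree_at_cuts {k : ℕ → ℕ} {c : ℕ → ℕ → Fin 3} (h : IsTower k c) (n q q' i : ℕ)
    (hi : i < hgt k n 2) :
    c 0 (cut k c (n + 2) q + i) = c 0 (cut k c (n + 2) q' + i) := by
  have key : ∀ j, compApply k n [2] <+: compApply k (n + 2) [j] := by
    intro j
    rw [compApply_add]
    refine compApply_isPrefix k n ?_
    fin_cases j <;> simp [compApply, applyChi, chiSub]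
  have key2 : ∀ q, c 0 (cut k c (n + 2) q + i) = (compApply k n [2])[i]'hi := by
    intro q
    have hp := key (c (n + 2) q)
    rw [h.block (n + 2) q (hi.trans_le hp.length_le)]
    exact (hp.getElem hi).symm
  rw [key2, key2]

/-- The limit words of the dropped sequences form a tower over `ρ`. -/
lemma exists_tower {k : ℕ → ℕ} {B N : ℕ} (hg : GoodSeq k B N) {ρ : ℕ → Fin 3}
    (hρ : ∀ n, IsPrefixSeq (compApply k n [2]) ρ) : ∃ c, IsTower k c ∧ c 0 = ρ := by
  have chain : ∀ (k : ℕ → ℕ) (m m' : ℕ), m ≤ m' → compApply k m [2] <+: compApply k m' [2] := by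
    intro k m m' hm
    induction m', hm using Nat.le_induction with
    | base => exact List.prefix_rfl
    | succ m' _ ih =>
      refine ih.trans (compApply_isPrefix k m' ?_)
      rw [applyChi_singleton, chiSub_two]
      exact ⟨List.replicate _ 0, rfl⟩
  have large : ∀ n i, ∃ m, i < (compApply (dropSeq k n) m [2]).length := by
    intro n i
    obtain ⟨m, hm⟩ := (hg.dropSeq n).hgt_large (i + 1)
    exact ⟨m, hm m le_rfl 2⟩
  choose m hm using large
  have hpre : ∀ n M, IsPrefixSeq (compApply (dropSeq k n) M [2])
      (fun i => (compApply (dropSeq k n) (m n i) [2])[i]'(hm n i)) := by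
    intro n M
    refine isPrefixSeq_of_getElem fun i hi => ?_
    rcases le_total M (m n i) with h | h
    · exact (chain (dropSeq k n) _ _ h).getElem hi
    · exact ((chain (dropSeq k n) _ _ h).getElem (hm n i)).symm
  refine ⟨fun n i => (compApply (dropSeq k n) (m n i) [2])[i]'(hm n i), ?_, ?_⟩
  · intro n M
    obtain ⟨M', hM'⟩ := (hg.dropSeq (n + 1)).hgt_large M
    have h1 := pre_isPrefix (hpre (n + 1) M') (hM' M' le_rfl 2)
    have h2 := hpre n (1 + M')
    rw [compApply_add] at h2
    have e : dropSeq (dropSeq k n) 1 = dropSeq k (n + 1) := by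
      funext i; simp [dropSeq, add_assoc]
    rw [e] at h2
    exact h2.of_isPrefix (compApply_isPrefix (dropSeq k n) 1 h1)
  · funext i
    have e : dropSeq k 0 = k := by funext i; simp [dropSeq]
    have := (hρ (m 0 i)).getElem (i := i) (by simpa [e] using hm 0 i)
    simp only [e]
    exact this

/-! ### Uniform convergence of averages along a tower -/

/-- The averages of `b` over all blocks of level `n` are at most `β`. -/
def BlockLe (k : ℕ → ℕ) (c : ℕ → ℕ → Fin 3) (b : ℕ → ℝ) (n : ℕ) (β : ℝ) : Prop :=
  ∀ r, ∑ i ∈ Finset.Ico (cut k c n r) (cut k c n (r + 1)), b i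
    ≤ β * ((cut k c n (r + 1) : ℝ) - cut k c n r)

lemma BlockLe.sum_Ico_le {k : ℕ → ℕ} {c : ℕ → ℕ → Fin 3} {b : ℕ → ℝ} {n : ℕ} {β : ℝ}
    (h : BlockLe k c b n β) {q q' : ℕ} (hq : q ≤ q') :
    ∑ i ∈ Finset.Ico (cut k c n q) (cut k c n q'), b i
      ≤ β * ((cut k c n q' : ℝ) - cut k c n q) := by
  induction q', hq using Nat.le_induction with
  | base => simp
  | succ q' hq ih =>
    have hm := (cut_strictMono k c n).monotone
    rw [← Finset.sum_Ico_consecutive b (hm hq) (hm (Nat.le_succ q'))]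
    have := h q'
    simp only [Nat.succ_eq_add_one]
    linarith

lemma cut_succ_sub (k : ℕ → ℕ) (c : ℕ → ℕ → Fin 3) (n q : ℕ) :
    ((cut k c n (q + 1) : ℝ) - cut k c n q) = hgt k n (c n q) := by
  rw [cut_succ]; push_cast; ring

lemma BlockLe.improve {k : ℕ → ℕ} {c : ℕ → ℕ → Fin 3} {B N : ℕ} (hg : GoodSeq k B N)
    (ht : IsTower k c) {b : ℕ → ℝ} {n : ℕ} {β y δ : ℝ} (h : BlockLe k c b n β)
    (hδ0 : 0 ≤ δ)
    (hδ : ∀ j, δ * hgt k (n + (2 * N + 4)) j ≤ hgt k n 2)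
    (hy : ∀ r, c n r = 2 → ∑ i ∈ Finset.Ico (cut k c n r) (cut k c n (r + 1)), b i
      ≤ y * hgt k n 2) :
    BlockLe k c b (n + (2 * N + 4)) (β - δ * (β - y)) := by
  intro q
  obtain ⟨r, ha, h1, h2⟩ := ht.exists_sub_block hg n q 2
  have hlen := cut_succ_sub k c (n + (2 * N + 4)) q
  have hd := hδ (c (n + (2 * N + 4)) q)
  rw [← hlen] at hd
  rw [ht.cut_add, ht.cut_add] at hd ⊢
  set t := cut (dropSeq k n) (fun i => c (n + i)) (2 * N + 4) q
  set t' := cut (dropSeq k n) (fun i => c (n + i)) (2 * N + 4) (q + 1)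
  have hm := (cut_strictMono k c n).monotone
  rw [← Finset.sum_Ico_consecutive b (hm h1) (hm h2.le),
    ← Finset.sum_Ico_consecutive b (hm (Nat.le_succ r)) (hm (Nat.succ_le_of_lt h2))]
  have s1 := h.sum_Ico_le h1
  have s2 := h.sum_Ico_le (Nat.succ_le_of_lt h2)
  have s3 := hy r ha
  have s4 := h r
  have e := cut_succ_sub k c n r
  rw [ha] at e
  simp only [Nat.succ_eq_add_one] at s1 s2 s3 s4 ⊢
  rw [e] at s4
  rw [sub_eq_iff_eq_add] at e
  rw [e] at s2
  rcases le_or_gt y β with hyb | hyb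
  · have := mul_le_mul_of_nonneg_right hd (sub_nonneg.2 hyb)
    linarith
  · have hlen0 : (0 : ℝ) ≤ (cut k c n t' : ℝ) - cut k c n t :=
      sub_nonneg.2 (by exact_mod_cast hm (h1.trans h2.le))
    have := mul_nonneg (mul_nonneg hδ0 (sub_nonneg.2 hyb.le)) hlen0
    linarith

lemma exists_blockLe_improve {k : ℕ → ℕ} {c : ℕ → ℕ → Fin 3} {B N : ℕ} (hg : GoodSeq k B N)
    (ht : IsTower k c) {b : ℕ → ℝ} {n : ℕ} {α β δ ε : ℝ} (hδ0 : 0 ≤ δ) (hδ1 : δ ≤ 1) (hε : 0 ≤ ε)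
    (hδ : ∀ j, δ * hgt k (n + (2 * N + 4)) j ≤ hgt k n 2)
    (hclose : ∀ r r', c n r = 2 → c n r' = 2 →
      |∑ i ∈ Finset.Ico (cut k c n r) (cut k c n (r + 1)), b i
        - ∑ i ∈ Finset.Ico (cut k c n r') (cut k c n (r' + 1)), b i| ≤ ε * hgt k n 2)
    (h : BlockLe k c b n β) (h' : BlockLe k c (fun i => -b i) n (-α)) :
    ∃ α' β', BlockLe k c b (n + (2 * N + 4)) β' ∧
      BlockLe k c (fun i => -b i) (n + (2 * N + 4)) (-α') ∧
      β' - α' ≤ (1 - δ) * (β - α) + 2 * ε := by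
  obtain ⟨r₀, hr₀, -⟩ := ht.exists_block_ge hg n 0 2
  have hpos : (0 : ℝ) < hgt k n 2 := by exact_mod_cast hgt_pos k n 2
  obtain ⟨x, hx⟩ : ∃ x, ∑ i ∈ Finset.Ico (cut k c n r₀) (cut k c n (r₀ + 1)), b i
      = x * hgt k n 2 := ⟨_, (div_mul_cancel₀ _ hpos.ne').symm⟩
  have u := h.improve hg ht (y := x + ε) hδ0 hδ (fun r hr => by
    have := (abs_le.1 (hclose r r₀ hr hr₀)).2
    rw [hx] at this
    linarith)
  have l := h'.improve hg ht (y := -(x - ε)) hδ0 hδ (fun r hr => by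
    have := (abs_le.1 (hclose r r₀ hr hr₀)).1
    rw [hx] at this
    rw [Finset.sum_neg_distrib]
    linarith)
  refine ⟨α + δ * (x - ε - α), _, u, ?_, ?_⟩
  · convert l using 1
    ring
  · nlinarith

lemma exists_blockLe_gap_le {k : ℕ → ℕ} {c : ℕ → ℕ → Fin 3} {B N : ℕ} (hg : GoodSeq k B N)
    (ht : IsTower k c) {b : ℕ → ℝ} {C : ℝ} (hb : ∀ i, |b i| ≤ C)
    (hclose : ∀ ε > 0, ∃ n₀, ∀ n ≥ n₀, ∀ r r', c n r = 2 → c n r' = 2 →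
      |∑ i ∈ Finset.Ico (cut k c n r) (cut k c n (r + 1)), b i
        - ∑ i ∈ Finset.Ico (cut k c n r') (cut k c n (r' + 1)), b i| ≤ ε * hgt k n 2)
    {ε : ℝ} (hε : 0 < ε) :
    ∃ n α β, BlockLe k c b n β ∧ BlockLe k c (fun i => -b i) n (-α) ∧ β - α ≤ ε := by
  obtain ⟨D, hD0, hD⟩ := hg.exists_total_le_mul_hgt
  set A : ℝ := (2 * B + 2) ^ (2 * N + 4) * D with hA
  have hA0 : 1 ≤ A := by
    have : 1 ≤ (2 * B + 2) ^ (2 * N + 4) * D := Nat.mul_pos (by positivity) hD0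
    rw [hA]
    exact_mod_cast this
  have hδ : ∀ n j, A⁻¹ * hgt k (n + (2 * N + 4)) j ≤ hgt k n 2 := by
    intro n j
    rw [inv_mul_le_iff₀ (by linarith)]
    have h1 : hgt k (n + (2 * N + 4)) j ≤ (2 * B + 2) ^ (2 * N + 4) * D * hgt k n 2 :=
      calc _ ≤ totalHgt k (n + (2 * N + 4)) := hgt_le_total _ _ _
        _ ≤ (2 * B + 2) ^ (2 * N + 4) * totalHgt k n := hg.total_add_le _ _
        _ ≤ (2 * B + 2) ^ (2 * N + 4) * (D * hgt k n 2) := Nat.mul_le_mul_left _ (hD n 2)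
        _ = _ := by ring
    rw [hA]
    exact_mod_cast h1
  have hδ0 : 0 < A⁻¹ := by positivity
  have hδ1 : A⁻¹ ≤ 1 := inv_le_one_of_one_le₀ hA0
  set δ := A⁻¹
  obtain ⟨n₀, hn₀⟩ := hclose (ε * δ / 4) (by positivity)
  have iter : ∀ j, ∃ α β, BlockLe k c b (n₀ + j * (2 * N + 4)) β ∧
      BlockLe k c (fun i => -b i) (n₀ + j * (2 * N + 4)) (-α) ∧
      β - α ≤ (1 - δ) ^ j * (2 * C) + ε / 2 := by
    intro j
    induction j with
    | zero =>
      have gen : ∀ b' : ℕ → ℝ, (∀ i, b' i ≤ C) → BlockLe k c b' (n₀ + 0 * (2 * N + 4)) C := by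
        intro b' hb' r
        have hle := (cut_strictMono k c (n₀ + 0 * (2 * N + 4))).monotone (Nat.le_succ r)
        refine (Finset.sum_le_card_nsmul _ _ C fun i _ => hb' i).trans (le_of_eq ?_)
        rw [Nat.card_Ico, nsmul_eq_mul, Nat.cast_sub hle]
        simp only [Nat.succ_eq_add_one]
        ring
      refine ⟨-C, C, gen b fun i => (abs_le.1 (hb i)).2, ?_, ?_⟩
      · rw [neg_neg]
        exact gen _ fun i => by linarith [(abs_le.1 (hb i)).1]
      · linarith
    | succ j ih =>
      obtain ⟨α, β, h1, h2, h3⟩ := ih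
      obtain ⟨α', β', h4, h5, h6⟩ := exists_blockLe_improve hg ht (n := n₀ + j * (2 * N + 4))
        hδ0.le hδ1 (by positivity : (0 : ℝ) ≤ ε * δ / 4) (hδ _) (hn₀ _ (by omega)) h1 h2
      refine ⟨α', β', ?_, ?_, ?_⟩
      · convert h4 using 1; ring
      · convert h5 using 1; ring
      · have := mul_le_mul_of_nonneg_left h3 (sub_nonneg.2 hδ1)
        rw [pow_succ]
        nlinarith
  have hlim : Tendsto (fun j : ℕ => (1 - δ) ^ j * (2 * C)) atTop (𝓝 (0 * (2 * C))) :=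
    (tendsto_pow_atTop_nhds_zero_of_lt_one (by linarith) (by linarith)).mul_const _
  rw [zero_mul] at hlim
  obtain ⟨j, hj⟩ := (hlim.eventually (gt_mem_nhds (half_pos hε))).exists
  obtain ⟨α, β, h1, h2, h3⟩ := iter j
  exact ⟨_, α, β, h1, h2, by linarith⟩

lemma abs_sum_Ico_le {b : ℕ → ℝ} {C : ℝ} (hb : ∀ i, |b i| ≤ C) {p q L : ℕ} (hq : q ≤ p + L) :
    |∑ i ∈ Finset.Ico p q, b i| ≤ C * L := by
  have hC : 0 ≤ C := (abs_nonneg _).trans (hb 0)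
  calc _ ≤ ∑ i ∈ Finset.Ico p q, |b i| := Finset.abs_sum_le_sum_abs _ _
    _ ≤ (Finset.Ico p q).card • C := Finset.sum_le_card_nsmul _ _ _ fun i _ => hb i
    _ = (q - p : ℕ) * C := by simp
    _ ≤ L * C := by
      gcongr
      omega
    _ = _ := mul_comm _ _

lemma BlockLe.window_le {k : ℕ → ℕ} {c : ℕ → ℕ → Fin 3} {b : ℕ → ℝ} {n : ℕ} {β C : ℝ}
    (hb : ∀ i, |b i| ≤ C) (h : BlockLe k c b n β) {ℓ : ℕ} (hℓ : totalHgt k n ≤ ℓ) (p : ℕ) :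
    ∑ i ∈ Finset.Ico p (p + ℓ), b i ≤ β * ℓ + (2 * C + |β|) * totalHgt k n := by
  obtain ⟨q, h1, h2⟩ := exists_cut_ge k c n p
  obtain ⟨q', h3, h4⟩ := exists_cut_ge k c n (p + ℓ)
  have hm := cut_strictMono k c n
  have hqq : cut k c n q ≤ cut k c n q' := by omega
  have hq : q ≤ q' := hm.le_iff_le.1 hqq
  have s1 := (abs_le.1 (abs_sum_Ico_le hb h2)).2
  have s2 := (abs_le.1 (abs_sum_Ico_le hb h4)).1
  have s3 := h.sum_Ico_le hq
  have e1 := Finset.sum_Ico_consecutive b h1 hqq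
  have e2 := Finset.sum_Ico_consecutive b (show p ≤ p + ℓ by omega) h3
  have hx : |((cut k c n q' : ℝ) - cut k c n q) - ℓ| ≤ totalHgt k n := by
    have h1' : (p : ℝ) ≤ cut k c n q := by exact_mod_cast h1
    have h2' : (cut k c n q : ℝ) ≤ p + totalHgt k n := by exact_mod_cast h2
    have h3' : (p + ℓ : ℝ) ≤ cut k c n q' := by exact_mod_cast h3
    have h4' : (cut k c n q' : ℝ) ≤ p + ℓ + totalHgt k n := by exact_mod_cast h4
    rw [abs_le]
    constructor <;> linarith
  have hy : β * (((cut k c n q' : ℝ) - cut k c n q) - ℓ) ≤ |β| * totalHgt k n := by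
    refine (le_abs_self _).trans ?_
    rw [abs_mul]
    gcongr
  nlinarith

theorem exists_uniform_average {k : ℕ → ℕ} {c : ℕ → ℕ → Fin 3} {B N : ℕ} (hg : GoodSeq k B N)
    (ht : IsTower k c) {b : ℕ → ℝ} {C : ℝ} (hb : ∀ i, |b i| ≤ C)
    (hclose : ∀ ε > 0, ∃ n₀, ∀ n ≥ n₀, ∀ r r', c n r = 2 → c n r' = 2 →
      |∑ i ∈ Finset.Ico (cut k c n r) (cut k c n (r + 1)), b i
        - ∑ i ∈ Finset.Ico (cut k c n r') (cut k c n (r' + 1)), b i| ≤ ε * hgt k n 2)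
    {ε : ℝ} (hε : 0 < ε) :
    ∃ (ℓ : ℕ) (m : ℝ), 0 < ℓ ∧ ∀ p, |∑ i ∈ Finset.Ico p (p + ℓ), b i - m * ℓ| ≤ ε * ℓ := by
  obtain ⟨n, α, β, h1, h2, h3⟩ := exists_blockLe_gap_le hg ht hb hclose (half_pos hε)
  set K : ℝ := (2 * C + |β| + |α|) * totalHgt k n with hK
  have hC : 0 ≤ C := (abs_nonneg _).trans (hb 0)
  obtain ⟨ℓ, hℓ⟩ := exists_nat_ge (max (totalHgt k n : ℝ) (K / (ε / 2)))
  have hℓ1 : totalHgt k n ≤ ℓ := by exact_mod_cast (le_max_left _ _).trans hℓ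
  have hℓ2 : K ≤ ε / 2 * ℓ := by
    have := (le_max_right _ _).trans hℓ
    rwa [div_le_iff₀' (by positivity)] at this
  have hpos : 0 < ℓ := (hgt_pos k n 0).trans ((hgt_le_total k n 0).trans hℓ1)
  refine ⟨ℓ, β, hpos, fun p => ?_⟩
  have u := h1.window_le hb hℓ1 p
  have l := h2.window_le (C := C) (fun i => by simpa using hb i) hℓ1 p
  rw [Finset.sum_neg_distrib, abs_neg] at l
  have hβ : 0 ≤ |β| * totalHgt k n := by positivity
  have hα : 0 ≤ |α| * totalHgt k n := by positivity
  have h4 : (β - α) * ℓ ≤ ε / 2 * ℓ := by gcongr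
  rw [abs_le]
  constructor
  · nlinarith
  · nlinarith [mul_pos hε (Nat.cast_pos.2 hpos : (0 : ℝ) < ℓ)]

lemma continuous_shift : Continuous shift := continuous_pi fun i => continuous_apply (i + 1)

/-- The `n`-th point of the orbit of `ρ` under the shift. -/
def orb (ρ : ℕ → Fin 3) (n : ℕ) : ℕ → Fin 3 := fun i => ρ (i + n)

lemma shift_orb (ρ : ℕ → Fin 3) (n : ℕ) : shift (orb ρ n) = orb ρ (n + 1) := by
  ext i; simp [shift, orb, add_assoc, add_comm 1 n]

lemma shift_iterate_apply (x : ℕ → Fin 3) (n i : ℕ) : (shift^[n] x) i = x (i + n) := by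
  induction n generalizing x with
  | zero => rfl
  | succ n ih => rw [Function.iterate_succ_apply, ih]; simp [shift, add_assoc]

lemma shift_iterate_orb (ρ : ℕ → Fin 3) (n j : ℕ) : shift^[j] (orb ρ n) = orb ρ (n + j) := by
  ext i; rw [shift_iterate_apply]; simp [orb]; congr 2; omega

lemma orbitClosure_eq (ρ : ℕ → Fin 3) : orbitClosure ρ = closure (Set.range (orb ρ)) := by
  unfold orbitClosure
  congr 1
  ext y
  exact ⟨fun ⟨n, h⟩ => ⟨n, h.symm⟩, fun ⟨n, h⟩ => ⟨n, h.symm⟩⟩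

lemma isClosed_orbitClosure (ρ : ℕ → Fin 3) : IsClosed (orbitClosure ρ) := isClosed_closure

lemma orb_mem_orbitClosure (ρ : ℕ → Fin 3) (n : ℕ) : orb ρ n ∈ orbitClosure ρ := by
  rw [orbitClosure_eq]
  exact subset_closure ⟨n, rfl⟩

lemma exists_agree_dist_lt {E : Type*} [PseudoMetricSpace E] {φ : (ℕ → Fin 3) → E}
    (hφ : Continuous φ) {ε : ℝ} (hε : 0 < ε) :
    ∃ L : ℕ, ∀ x y : ℕ → Fin 3, (∀ i < L, x i = y i) → dist (φ x) (φ y) < ε := by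
  have h1 : ∀ x : ℕ → Fin 3, ∃ n, PiNat.cylinder x n ⊆ φ ⁻¹' Metric.ball (φ x) (ε / 2) := by
    intro x
    have ho : IsOpen (φ ⁻¹' Metric.ball (φ x) (ε / 2)) := Metric.isOpen_ball.preimage hφ
    obtain ⟨v, ⟨y, n, rfl⟩, hx, hv⟩ := (PiNat.isTopologicalBasis_cylinders
      (fun _ : ℕ => Fin 3)).exists_subset_of_mem_open
      (show x ∈ φ ⁻¹' Metric.ball (φ x) (ε / 2) by simpa using half_pos hε) ho
    refine ⟨n, ?_⟩
    rwa [PiNat.mem_cylinder_iff_eq.1 hx]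
  choose n hn using h1
  obtain ⟨t, -, ht⟩ := (isCompact_univ (X := ℕ → Fin 3)).elim_nhds_subcover
    (fun x => PiNat.cylinder x (n x))
    (fun x _ => (PiNat.isOpen_cylinder _ x (n x)).mem_nhds (PiNat.self_mem_cylinder x _))
  refine ⟨t.sup n, fun x y hxy => ?_⟩
  obtain ⟨z, hz, hxz⟩ := Set.mem_iUnion₂.1 (ht (Set.mem_univ x))
  have hyz : y ∈ PiNat.cylinder z (n z) := by
    rw [PiNat.mem_cylinder_iff] at hxz ⊢
    intro i hi
    rw [← hxz i hi, hxy i (hi.trans_le (Finset.le_sup hz))]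
  have a := hn z hxz
  have b := hn z hyz
  simp only [Set.mem_preimage, Metric.mem_ball] at a b
  rw [dist_comm] at b
  linarith [dist_triangle (φ x) (φ z) (φ y)]

lemma Continuous.integrable_of_seq {E : Type*} [NormedAddCommGroup E] [SecondCountableTopology E]
    {φ : (ℕ → Fin 3) → E} (hφ : Continuous φ) (μ : Measure (ℕ → Fin 3)) [IsFiniteMeasure μ] :
    Integrable φ μ := by
  obtain ⟨C, hC⟩ := (isCompact_univ.image hφ).isBounded.exists_norm_le
  exact Integrable.of_bound hφ.aestronglyMeasurable C
    (ae_of_all _ fun x => hC _ ⟨x, Set.mem_univ _, rfl⟩)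

lemma IsInvProb.measurePreserving {X : Set (ℕ → Fin 3)} {μ : Measure (ℕ → Fin 3)}
    (h : IsInvProb X μ) : MeasurePreserving shift μ μ :=
  ⟨continuous_shift.measurable, h.2.2⟩

lemma ae_of_orb {ρ : ℕ → Fin 3} {μ : Measure (ℕ → Fin 3)} (h : IsInvProb (orbitClosure ρ) μ)
    {s : Set (ℕ → Fin 3)} (hs : IsClosed s) (ho : ∀ n, orb ρ n ∈ s) : ∀ᵐ x ∂μ, x ∈ s := by
  have : orbitClosure ρ ⊆ s := by
    rw [orbitClosure_eq]
    exact closure_minimal (by rintro _ ⟨n, rfl⟩; exact ho n) hs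
  rw [ae_iff]
  exact measure_mono_null (fun x hx hx' => hx (this hx')) h.2.1

lemma IsInvProb.integral_window {X : Set (ℕ → Fin 3)} {μ : Measure (ℕ → Fin 3)}
    (h : IsInvProb X μ) {φ : (ℕ → Fin 3) → ℝ} (hφ : Continuous φ) (ℓ : ℕ) :
    ∫ x, ∑ i ∈ Finset.range ℓ, φ (shift^[i] x) ∂μ = ℓ * ∫ x, φ x ∂μ := by
  have := h.1
  have hi : ∀ i, Integrable (fun x => φ (shift^[i] x)) μ := fun i =>
    (hφ.comp (continuous_shift.iterate i)).integrable_of_seq μ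
  rw [integral_finsetSum _ fun i _ => hi i]
  have : ∀ i, ∫ x, φ (shift^[i] x) ∂μ = ∫ x, φ x ∂μ := fun i => by
    have hm := h.measurePreserving.iterate i
    conv_rhs => rw [← hm.map_eq]
    rw [integral_map hm.measurable.aemeasurable hφ.aestronglyMeasurable]
  simp [this]

lemma IsInvProb.abs_integral_sub_le {ρ : ℕ → Fin 3} {μ : Measure (ℕ → Fin 3)}
    (h : IsInvProb (orbitClosure ρ) μ) {φ : (ℕ → Fin 3) → ℝ} (hφ : Continuous φ) {ℓ : ℕ}
    (hℓ : 0 < ℓ) {m ε : ℝ}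
    (hb : ∀ p, |∑ i ∈ Finset.Ico p (p + ℓ), φ (orb ρ i) - m * ℓ| ≤ ε * ℓ) :
    |∫ x, φ x ∂μ - m| ≤ ε := by
  have := h.1
  have hc : Continuous fun x => ∑ i ∈ Finset.range ℓ, φ (shift^[i] x) :=
    continuous_finsetSum _ fun i _ => hφ.comp (continuous_shift.iterate i)
  have hae : ∀ᵐ x ∂μ, ‖∑ i ∈ Finset.range ℓ, φ (shift^[i] x) - m * ℓ‖ ≤ ε * ℓ := by
    refine ae_of_orb h (s := {x | ‖∑ i ∈ Finset.range ℓ, φ (shift^[i] x) - m * ℓ‖ ≤ ε * ℓ})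
      (isClosed_le (by fun_prop) continuous_const) fun p => ?_
    have := hb p
    rw [Finset.sum_Ico_eq_sum_range] at this
    simpa [shift_iterate_orb] using this
  have h1 := norm_integral_le_of_norm_le_const hae
  rw [integral_sub (hc.integrable_of_seq μ) (integrable_const _), h.integral_window hφ] at h1
  simp only [integral_const, probReal_univ, one_smul, mul_one, Real.norm_eq_abs] at h1
  rw [show (ℓ : ℝ) * ∫ x, φ x ∂μ - m * ℓ = (∫ x, φ x ∂μ - m) * ℓ by ring, abs_mul,
    Nat.abs_cast] at h1
  exact le_of_mul_le_mul_right h1 (by exact_mod_cast hℓ)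

lemma exists_window_average {k : ℕ → ℕ} {c : ℕ → ℕ → Fin 3} {B N : ℕ} (hg : GoodSeq k B N)
    (ht : IsTower k c) {φ : (ℕ → Fin 3) → ℝ} (hφ : Continuous φ) {ε : ℝ} (hε : 0 < ε) :
    ∃ (ℓ : ℕ) (m : ℝ), 0 < ℓ ∧
      ∀ p, |∑ i ∈ Finset.Ico p (p + ℓ), φ (orb (c 0) i) - m * ℓ| ≤ ε * ℓ := by
  obtain ⟨C, hC⟩ := (isCompact_univ.image hφ).isBounded.exists_norm_le
  have hb : ∀ x, |φ x| ≤ C := fun x => hC _ ⟨x, Set.mem_univ _, rfl⟩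
  have hC0 : 0 ≤ C := (abs_nonneg _).trans (hb (c 0))
  refine exists_uniform_average hg ht (b := fun i => φ (orb (c 0) i)) (fun i => hb _)
    (fun ε hε => ?_) hε
  obtain ⟨L, hL⟩ := exists_agree_dist_lt hφ (half_pos hε)
  obtain ⟨K, hK⟩ := exists_nat_ge (2 * C * L / (ε / 2))
  obtain ⟨n₀, hn₀⟩ := hg.hgt_large K
  refine ⟨n₀, fun n hn r r' hr hr' => ?_⟩
  set h := hgt k n 2 with hh
  have hK' : 2 * C * L ≤ ε / 2 * h := by
    have h1 : (K : ℝ) ≤ h := by exact_mod_cast hn₀ n hn 2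
    have := hK.trans h1
    rwa [div_le_iff₀' (by positivity)] at this
  rw [cut_succ, cut_succ, hr, hr', Finset.sum_Ico_eq_sum_range, Finset.sum_Ico_eq_sum_range,
    Nat.add_sub_cancel_left, Nat.add_sub_cancel_left, ← hh, ← Finset.sum_sub_distrib]
  have hterm : ∀ i ∈ Finset.range h, |φ (orb (c 0) (cut k c n r + i))
      - φ (orb (c 0) (cut k c n r' + i))| ≤ ε / 2 + if h < i + L then 2 * C else 0 := by
    intro i hi
    split_ifs with hi'
    · refine (abs_sub _ _).trans ?_
      linarith [hb (orb (c 0) (cut k c n r + i)), hb (orb (c 0) (cut k c n r' + i))]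
    · rw [add_zero, ← Real.dist_eq]
      refine (hL _ _ fun j hj => ?_).le
      have e1 := ht.block n r (i := i + j) (by rw [hr]; exact (by omega : i + j < h))
      have e2 := ht.block n r' (i := i + j) (by rw [hr']; exact (by omega : i + j < h))
      simp only [orb]
      rw [show j + (cut k c n r + i) = cut k c n r + (i + j) by omega,
        show j + (cut k c n r' + i) = cut k c n r' + (i + j) by omega, e1, e2]
      simp only [hr, hr']
  refine (Finset.abs_sum_le_sum_abs _ _).trans ((Finset.sum_le_sum hterm).trans ?_)
  rw [Finset.sum_add_distrib, ← Finset.sum_filter]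
  have hcard : ((Finset.range h).filter fun i => h < i + L).card ≤ L := by
    refine (Finset.card_le_card (t := Finset.Ico (h + 1 - L) (h + 1 - L + L)) ?_).trans (by simp)
    intro i hi
    simp only [Finset.mem_filter, Finset.mem_range, Finset.mem_Ico] at hi ⊢
    omega
  have : ((((Finset.range h).filter fun i => h < i + L).card : ℕ) : ℝ) ≤ L := by
    exact_mod_cast hcard
  simp only [Finset.sum_const, Finset.card_range, nsmul_eq_mul]
  nlinarith

theorem IsInvProb.eq {k : ℕ → ℕ} {c : ℕ → ℕ → Fin 3} {B N : ℕ} (hg : GoodSeq k B N)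
    (ht : IsTower k c) {μ ν : Measure (ℕ → Fin 3)} (hμ : IsInvProb (orbitClosure (c 0)) μ)
    (hν : IsInvProb (orbitClosure (c 0)) ν) : μ = ν := by
  have := hμ.1
  have := hν.1
  refine ext_of_forall_integral_eq_of_IsFiniteMeasure fun f => ?_
  refine eq_of_forall_dist_le fun ε hε => ?_
  obtain ⟨ℓ, m, hℓ, hm⟩ := exists_window_average hg ht f.continuous (half_pos hε)
  have h1 := hμ.abs_integral_sub_le f.continuous hℓ hm
  have h2 := hν.abs_integral_sub_le f.continuous hℓ hm
  rw [abs_sub_comm] at h2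
  rw [Real.dist_eq]
  linarith [abs_sub_le (∫ x, f x ∂μ) m (∫ x, f x ∂ν)]

/-- The uniform probability measure on the first `n + 1` points of the orbit of `ρ`. -/
noncomputable def empirical (ρ : ℕ → Fin 3) (n : ℕ) : Measure (ℕ → Fin 3) :=
  ((n + 1 : ℕ) : ENNReal)⁻¹ • ∑ i ∈ Finset.range (n + 1), Measure.dirac (orb ρ i)

instance isProbabilityMeasure_empirical (ρ : ℕ → Fin 3) (n : ℕ) :
    IsProbabilityMeasure (empirical ρ n) := ⟨by
  simp only [empirical, Measure.smul_apply, Measure.finsetSum_apply, measure_univ, smul_eq_mul,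
    Finset.sum_const, Finset.card_range, nsmul_eq_mul, mul_one]
  exact ENNReal.inv_mul_cancel (by simp) (by simp)⟩

lemma integral_empirical (ρ : ℕ → Fin 3) (n : ℕ) {φ : (ℕ → Fin 3) → ℝ} (hφ : Continuous φ) :
    ∫ x, φ x ∂empirical ρ n = ((n : ℝ) + 1)⁻¹ * ∑ i ∈ Finset.range (n + 1), φ (orb ρ i) := by
  rw [empirical, integral_smul_measure, integral_finsetSum_measure fun i _ => hφ.integrable_of_seq _]
  simp [ENNReal.toReal_add]

lemma empirical_compl (ρ : ℕ → Fin 3) (n : ℕ) : empirical ρ n (orbitClosure ρ)ᶜ = 0 := by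
  have h := (isClosed_orbitClosure ρ).measurableSet.compl
  simp [empirical, Measure.dirac_apply' _ h, orb_mem_orbitClosure]

theorem exists_isInvProb (ρ : ℕ → Fin 3) : ∃ μ, IsInvProb (orbitClosure ρ) μ := by
  let P : ℕ → ProbabilityMeasure (ℕ → Fin 3) := fun n => ⟨empirical ρ n, inferInstance⟩
  let U : Ultrafilter ℕ := Filter.hyperfilter ℕ
  have hU : (U : Filter ℕ) ≤ atTop := Nat.hyperfilter_le_atTop
  obtain ⟨μ, -, hμ⟩ := isCompact_univ.ultrafilter_le_nhds (U.map P) (by simp)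
  have hP : Tendsto P U (𝓝 μ) := hμ
  refine ⟨μ, inferInstance, ?_, ?_⟩
  · have h := ProbabilityMeasure.le_liminf_measure_open_of_tendsto hP
      (isClosed_orbitClosure ρ).isOpen_compl
    have h0 : ∀ n, ((P n : Measure (ℕ → Fin 3)) (orbitClosure ρ)ᶜ) = 0 := empirical_compl ρ
    simpa [h0] using h
  · have := Measure.isProbabilityMeasure_map (μ := (μ : Measure (ℕ → Fin 3)))
      continuous_shift.measurable.aemeasurable
    refine ext_of_forall_integral_eq_of_IsFiniteMeasure fun f => ?_
    rw [integral_map continuous_shift.measurable.aemeasurable f.continuous.aestronglyMeasurable]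
    rw [ProbabilityMeasure.tendsto_iff_forall_integral_tendsto] at hP
    have h1 := hP f
    have h2 := hP (f.compContinuous ⟨shift, continuous_shift⟩)
    refine tendsto_nhds_unique h2 ?_
    have h3 : Tendsto (fun n : ℕ => ((n : ℝ) + 1)⁻¹ * (f (orb ρ (n + 1)) - f (orb ρ 0))) U
        (𝓝 0) := by
      refine Tendsto.mono_left ?_ hU
      have : Tendsto (fun n : ℕ => ((n : ℝ) + 1)⁻¹) atTop (𝓝 0) := by
        simpa using tendsto_one_div_add_atTop_nhds_zero_nat (𝕜 := ℝ)
      refine this.zero_mul_isBoundedUnder_le ?_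
      refine isBoundedUnder_of ⟨2 * ‖f‖, fun n => ?_⟩
      have a := f.norm_coe_le_norm (orb ρ (n + 1))
      have b := f.norm_coe_le_norm (orb ρ 0)
      refine (norm_sub_le _ _).trans (by linarith)
    have h4 := h1.add h3
    rw [add_zero] at h4
    refine h4.congr fun n => ?_
    change ∫ x, f x ∂empirical ρ n + _ = ∫ x, f (shift x) ∂empirical ρ n
    rw [integral_empirical ρ n f.continuous,
      integral_empirical ρ n (φ := fun x => f (shift x)) (f.continuous.comp continuous_shift),
      ← mul_add]
    congr 1
    simp only [shift_orb]
    rw [← Finset.sum_range_sub (fun i => f (orb ρ i)), ← Finset.sum_add_distrib]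
    simp

theorem IsInvProb.ergodic {k : ℕ → ℕ} {c : ℕ → ℕ → Fin 3} {B N : ℕ} (hg : GoodSeq k B N)
    (ht : IsTower k c) {μ : Measure (ℕ → Fin 3)} (hμ : IsInvProb (orbitClosure (c 0)) μ) :
    Ergodic shift μ := by
  have := hμ.1
  refine ⟨hμ.measurePreserving, ⟨fun s hs hinv => ?_⟩⟩
  rw [eventuallyConst_set']
  by_cases h0 : μ s = 0
  · exact Or.inl (ae_eq_empty.2 h0)
  right
  have hν : IsInvProb (orbitClosure (c 0)) (ProbabilityTheory.cond μ s) := by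
    refine ⟨ProbabilityTheory.cond_isProbabilityMeasure h0, ?_, ?_⟩
    · rw [ProbabilityTheory.cond_apply hs]
      simp [measure_mono_null Set.inter_subset_right hμ.2.1]
    · ext t htm
      rw [Measure.map_apply continuous_shift.measurable htm, ProbabilityTheory.cond_apply hs,
        ProbabilityTheory.cond_apply hs]
      congr 1
      conv_lhs => rw [← hinv]
      rw [← Set.preimage_inter]
      exact hμ.measurePreserving.measure_preimage (hs.inter htm).nullMeasurableSet
  have heq := hμ.eq hg ht hν
  have h1 : μ sᶜ = 0 := by
    rw [heq, ProbabilityTheory.cond_apply hs]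
    simp
  exact ae_eq_univ.2 h1

lemma eigen_iterate {X : Set (ℕ → Fin 3)} {μ : Measure (ℕ → Fin 3)} (h : IsInvProb X μ)
    {f : (ℕ → Fin 3) → ℂ} {c : ℂ}
    (hfc : (fun x => f (shift x)) =ᵐ[μ] fun x => c * f x) (n : ℕ) :
    (fun x => f (shift^[n] x)) =ᵐ[μ] fun x => c ^ n * f x := by
  induction n with
  | zero => simp
  | succ n ih =>
    have h1 := h.measurePreserving.quasiMeasurePreserving.ae ih
    filter_upwards [h1, hfc] with x hx hx'
    rw [Function.iterate_succ_apply, hx, hx', pow_succ]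
    ring

/-- For nonnegative reals, `t ↦ t / (1 + t)` is strictly increasing. -/
lemma div_one_add_le_iff {s t : ℝ} (hs : 0 ≤ s) (ht : 0 ≤ t) :
    s / (1 + s) ≤ t / (1 + t) ↔ s ≤ t := by
  rw [div_le_div_iff₀ (by positivity) (by positivity)]
  constructor <;> intro h <;> nlinarith

lemma eigen_norm_comp {X : Set (ℕ → Fin 3)} {μ : Measure (ℕ → Fin 3)} (h : IsInvProb X μ)
    {f : (ℕ → Fin 3) → ℂ} {c : ℂ} (hf : AEMeasurable f μ)
    (hfc : (fun x => f (shift x)) =ᵐ[μ] fun x => c * f x) :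
    (fun x => ‖f (shift x)‖) =ᵐ[μ] fun x => ‖f x‖ := by
  have := h.1
  have hm := h.measurePreserving
  set F : (ℕ → Fin 3) → ℝ := fun x => ‖f x‖ / (1 + ‖f x‖) with hF
  have hFm : AEStronglyMeasurable F μ :=
    (hf.norm.div (hf.norm.const_add 1)).aestronglyMeasurable
  have hFi : Integrable F μ := by
    refine Integrable.of_bound hFm 1 (ae_of_all _ fun x => ?_)
    rw [Real.norm_eq_abs, abs_of_nonneg (by positivity), div_le_one (by positivity)]
    linarith
  have hFσ : Integrable (fun x => F (shift x)) μ := hm.integrable_comp_of_integrable hFi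
  have hint : ∫ x, F (shift x) ∂μ = ∫ x, F x ∂μ := by
    conv_rhs => rw [← hm.map_eq]
    rw [integral_map hm.measurable.aemeasurable (by rw [hm.map_eq]; exact hFm)]
  have hc : ∀ᵐ x ∂μ, ‖f (shift x)‖ = ‖c‖ * ‖f x‖ := by
    filter_upwards [hfc] with x hx
    rw [hx, norm_mul]
  have heq : (fun x => F (shift x)) =ᵐ[μ] F := by
    rcases le_total ‖c‖ 1 with h1 | h1
    · refine (integral_eq_iff_of_ae_le hFσ hFi ?_).1 hint
      filter_upwards [hc] with x hx
      refine (div_one_add_le_iff (norm_nonneg _) (norm_nonneg _)).2 ?_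
      rw [hx]
      exact mul_le_of_le_one_left (norm_nonneg _) h1
    · refine ((integral_eq_iff_of_ae_le hFi hFσ ?_).1 hint.symm).symm
      filter_upwards [hc] with x hx
      refine (div_one_add_le_iff (norm_nonneg _) (norm_nonneg _)).2 ?_
      rw [hx]
      exact le_mul_of_one_le_left (norm_nonneg _) h1
  filter_upwards [heq] with x hx
  exact le_antisymm ((div_one_add_le_iff (norm_nonneg _) (norm_nonneg _)).1 hx.le)
    ((div_one_add_le_iff (norm_nonneg _) (norm_nonneg _)).1 hx.ge)

lemma eigen_norm {X : Set (ℕ → Fin 3)} {μ : Measure (ℕ → Fin 3)} (h : IsInvProb X μ)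
    (he : Ergodic shift μ) {f : (ℕ → Fin 3) → ℂ} {c : ℂ} (hf : AEMeasurable f μ)
    (hf0 : ¬ f =ᵐ[μ] 0) (hfc : (fun x => f (shift x)) =ᵐ[μ] fun x => c * f x) :
    ‖c‖ = 1 ∧ ∃ r > 0, ∀ᵐ x ∂μ, ‖f x‖ = r := by
  have := h.1
  have hn := eigen_norm_comp h hf hfc
  obtain ⟨r, hr⟩ := he.ae_eq_const_of_ae_eq_comp_ae hf.norm.aestronglyMeasurable hn
  have hr' : ∀ᵐ x ∂μ, ‖f x‖ = r := hr
  have hpos : 0 < r := by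
    refine lt_of_le_of_ne ?_ fun h0 => hf0 ?_
    · obtain ⟨x, hx⟩ := hr'.exists
      exact hx ▸ norm_nonneg _
    · filter_upwards [hr'] with x hx
      simpa [← h0] using hx
  refine ⟨?_, r, hpos, hr'⟩
  obtain ⟨x, h1, h2, h3⟩ := (hr'.and (hn.and hfc)).exists
  simp only at h2 h3
  rw [h3, norm_mul, h1] at h2
  exact mul_right_cancel₀ hpos.ne' (h2.trans (one_mul r).symm)

lemma IsInvProb.le_integral {ρ : ℕ → Fin 3} {μ : Measure (ℕ → Fin 3)}
    (h : IsInvProb (orbitClosure ρ) μ) {φ : (ℕ → Fin 3) → ℝ} (hφ : Continuous φ) {ℓ : ℕ} {A : ℝ}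
    (hb : ∀ p, A ≤ ∑ i ∈ Finset.Ico p (p + ℓ), φ (orb ρ i)) : A ≤ ℓ * ∫ x, φ x ∂μ := by
  have := h.1
  have hc : Continuous fun x => ∑ i ∈ Finset.range ℓ, φ (shift^[i] x) :=
    continuous_finsetSum _ fun i _ => hφ.comp (continuous_shift.iterate i)
  have hae : ∀ᵐ x ∂μ, A ≤ ∑ i ∈ Finset.range ℓ, φ (shift^[i] x) := by
    refine ae_of_orb h (s := {x | A ≤ ∑ i ∈ Finset.range ℓ, φ (shift^[i] x)})
      (isClosed_le continuous_const hc) fun p => ?_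
    have := hb p
    rw [Finset.sum_Ico_eq_sum_range] at this
    simpa [shift_iterate_orb] using this
  rw [← h.integral_window hφ]
  have := integral_mono_ae (integrable_const A) (hc.integrable_of_seq μ) hae
  simpa using this

/-- The set of sequences whose first `L` letters recur after `h` shifts. -/
def recurSet (L h : ℕ) : Set (ℕ → Fin 3) := {x | ∀ i < L, x i = x (i + h)}

lemma isClopen_recurSet (L h : ℕ) : IsClopen (recurSet L h) := by
  have : recurSet L h = ⋂ i ∈ Finset.range L, {x : ℕ → Fin 3 | x i = x (i + h)} := by
    ext x; simp [recurSet]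
  rw [this]
  refine isClopen_biInter_finset fun i _ => ?_
  have hc : Continuous fun x : ℕ → Fin 3 => (x i, x (i + h)) := by fun_prop
  exact (isClopen_discrete {p : Fin 3 × Fin 3 | p.1 = p.2}).preimage hc

lemma exists_recurSet_lower {k : ℕ → ℕ} {c : ℕ → ℕ → Fin 3} {B N : ℕ} (hg : GoodSeq k B N)
    (ht : IsTower k c) {μ : Measure (ℕ → Fin 3)} (hμ : IsInvProb (orbitClosure (c 0)) μ) :
    ∃ δ : ℝ, 0 < δ ∧ ∀ L, ∃ n₀, ∀ n ≥ n₀, ∀ a,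
      δ ≤ ∫ x, (recurSet L (hgt k n a)).indicator (fun _ => (1 : ℝ)) x ∂μ := by
  obtain ⟨D, hD, hDh⟩ := hg.exists_total_le_mul_hgt
  set M : ℕ := (2 * B + 2) ^ (2 + (2 * N + 4)) * D with hM
  have hM0 : (0 : ℝ) < M := by
    rw [hM]; push_cast; positivity
  refine ⟨1 / (4 * M), by positivity, fun L => ?_⟩
  obtain ⟨n₁, hn₁⟩ := hg.hgt_large (2 * L)
  refine ⟨n₁ + 2, fun n' hn' a => ?_⟩
  obtain ⟨n, rfl⟩ : ∃ n, n' = n + 2 := ⟨n' - 2, by omega⟩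
  set h := hgt k (n + 2) a with hh
  set g := hgt k n 2 with hgdef
  have hL : 2 * L ≤ g := hn₁ n (by omega) 2
  have hgh : g ≤ h := by
    have h2 := two_mem_of_two_le (dropSeq k n) le_rfl a
    rw [hh, hgt_add]
    exact List.single_le_sum (by simp) _ (List.mem_map_of_mem h2)
  set ℓ := 2 * totalHgt k (n + 2 + (2 * N + 4)) with hℓ
  have hℓM : ℓ ≤ 2 * (M * g) := by
    have h1 := hg.total_add_le n (2 + (2 * N + 4))
    rw [← add_assoc] at h1
    have h2 := Nat.mul_le_mul_left ((2 * B + 2) ^ (2 + (2 * N + 4))) (hDh n 2)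
    rw [← hgdef] at h2
    rw [hℓ, hM, mul_assoc]
    omega
  set E := recurSet L h with hE
  have hwin : ∀ p, (g : ℝ) / 2 ≤
      ∑ i ∈ Finset.Ico p (p + ℓ), E.indicator (fun _ => (1 : ℝ)) (orb (c 0) i) := by
    intro p
    obtain ⟨r, hr, hp, hp'⟩ := ht.exists_block_ge hg (n + 2) p a
    have hcut := cut_succ k c (n + 2) r
    rw [hr, ← hh] at hcut
    have hsub : Finset.Ico (cut k c (n + 2) r) (cut k c (n + 2) r + (g - L)) ⊆
        Finset.Ico p (p + ℓ) := Finset.Ico_subset_Ico hp (by omega)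
    refine le_trans ?_ (Finset.sum_le_sum_of_subset_of_nonneg hsub fun i _ _ =>
      Set.indicator_nonneg (fun _ _ => zero_le_one) _)
    have hone : ∀ i ∈ Finset.Ico (cut k c (n + 2) r) (cut k c (n + 2) r + (g - L)),
        E.indicator (fun _ => (1 : ℝ)) (orb (c 0) i) = 1 := by
      intro i hi
      rw [Finset.mem_Ico] at hi
      obtain ⟨j, rfl⟩ := Nat.exists_eq_add_of_le hi.1
      refine Set.indicator_of_mem ?_ _
      intro m hm
      have := ht.agree_at_cuts n r (r + 1) (j + m) (by omega)
      simp only [orb]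
      rw [show m + (cut k c (n + 2) r + j) = cut k c (n + 2) r + (j + m) by omega, this, hcut]
      congr 1
      omega
    rw [Finset.sum_congr rfl hone]
    simp only [Finset.sum_const, Nat.card_Ico, nsmul_eq_mul, mul_one, Nat.add_sub_cancel_left]
    rw [Nat.cast_sub (by omega)]
    have : (2 * L : ℝ) ≤ g := by exact_mod_cast hL
    linarith
  have hcont : Continuous (E.indicator fun _ => (1 : ℝ)) :=
    (isClopen_recurSet L h).continuous_indicator continuous_const
  have h1 := hμ.le_integral hcont hwin
  have hI : 0 ≤ ∫ x, E.indicator (fun _ => (1 : ℝ)) x ∂μ :=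
    integral_nonneg fun x => Set.indicator_nonneg (fun _ _ => zero_le_one) _
  have hℓ' : (ℓ : ℝ) ≤ 2 * (M * g) := by exact_mod_cast hℓM
  have hg0 : (0 : ℝ) < g := by exact_mod_cast hgt_pos k n 2
  rw [div_le_iff₀ (by positivity)]
  have h2 := h1.trans (mul_le_mul_of_nonneg_right hℓ' hI)
  have h3 : g * 1 ≤ g * ((∫ x, E.indicator (fun _ => (1 : ℝ)) x ∂μ) * (4 * M)) := by linarith
  exact le_of_mul_le_mul_left h3 hg0

/-- A measurable eigenvalue raised to the heights of the towers tends to one. -/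
theorem eigen_pow_hgt {k : ℕ → ℕ} {c : ℕ → ℕ → Fin 3} {B N : ℕ} (hg : GoodSeq k B N)
    (ht : IsTower k c) {μ : Measure (ℕ → Fin 3)} (hμ : IsInvProb (orbitClosure (c 0)) μ)
    {f : (ℕ → Fin 3) → ℂ} {z : ℂ} (hf : AEMeasurable f μ) (hf0 : ¬ f =ᵐ[μ] 0)
    (hfz : (fun x => f (shift x)) =ᵐ[μ] fun x => z * f x) (a : Fin 3) :
    Tendsto (fun n => z ^ hgt k n a) atTop (𝓝 1) := by
  have := hμ.1
  obtain ⟨-, r, hr, hfr⟩ := eigen_norm hμ (hμ.ergodic hg ht) hf hf0 hfz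
  obtain ⟨δ, hδ, hrec⟩ := exists_recurSet_lower hg ht hμ
  have hfi : Integrable f μ :=
    Integrable.of_bound hf.aestronglyMeasurable r (hfr.mono fun x hx => hx.le)
  rw [Metric.tendsto_atTop]
  intro ε hε
  set e := ε * r * δ / 4 with he
  have he0 : 0 < e := by positivity
  obtain ⟨φ, hφ, -⟩ := hfi.exists_boundedContinuous_integral_sub_le he0
  obtain ⟨L, hL⟩ := exists_agree_dist_lt φ.continuous he0
  obtain ⟨n₀, hn₀⟩ := hrec L
  refine ⟨n₀, fun n hn => ?_⟩
  have hI := hn₀ n hn a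
  set h := hgt k n a
  set E := recurSet L h with hE
  have hmp := hμ.measurePreserving.iterate h
  have hd : Integrable (fun x => ‖f x - φ x‖) μ := (hfi.sub (φ.integrable μ)).norm
  have hdσ : Integrable (fun x => ‖f (shift^[h] x) - φ (shift^[h] x)‖) μ :=
    hmp.integrable_comp_of_integrable hd
  have hint : ∫ x, ‖f (shift^[h] x) - φ (shift^[h] x)‖ ∂μ = ∫ x, ‖f x - φ x‖ ∂μ := by
    conv_rhs => rw [← hmp.map_eq]
    rw [integral_map hmp.measurable.aemeasurable
      (by rw [hmp.map_eq]; exact hd.aestronglyMeasurable)]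
  have hcont : Continuous (E.indicator fun _ => (1 : ℝ)) :=
    (isClopen_recurSet L h).continuous_indicator continuous_const
  have hpt : ∀ᵐ x ∂μ, r * ‖z ^ h - 1‖ * E.indicator (fun _ => (1 : ℝ)) x ≤
      ‖f (shift^[h] x) - φ (shift^[h] x)‖ + ‖f x - φ x‖ + e := by
    filter_upwards [hfr, eigen_iterate hμ hfz h] with x hx hx'
    by_cases hxE : x ∈ E
    · have h1 : r * ‖z ^ h - 1‖ = ‖f (shift^[h] x) - f x‖ := by
        rw [hx', ← hx, mul_comm, ← norm_mul]
        congr 1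
        ring
      have h2 := hL (shift^[h] x) x fun i hi => by
        rw [shift_iterate_apply]; exact (hxE i hi).symm
      rw [Set.indicator_of_mem hxE, mul_one, h1, ← dist_eq_norm, ← dist_eq_norm, ← dist_eq_norm]
      have h3 := dist_triangle4 (f (shift^[h] x)) (φ (shift^[h] x)) (φ x) (f x)
      rw [dist_comm (φ x) (f x)] at h3
      linarith
    · rw [Set.indicator_of_notMem hxE, mul_zero]
      positivity
  have h1 := integral_mono_ae ((hcont.integrable_of_seq μ).const_mul _)
    ((hdσ.add hd).add (integrable_const e)) hpt
  rw [integral_const_mul, integral_add' (hdσ.add hd) (integrable_const e),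
    integral_add' hdσ hd, hint] at h1
  simp only [integral_const, probReal_univ, one_smul] at h1
  rw [dist_eq_norm]
  have h2 : r * ‖z ^ h - 1‖ * δ ≤ 3 * e := by
    have := mul_le_mul_of_nonneg_left hI (by positivity : 0 ≤ r * ‖z ^ h - 1‖)
    linarith
  by_contra hcon
  push Not at hcon
  have h3 : r * ε * δ ≤ r * ‖z ^ h - 1‖ * δ := by gcongr
  linarith

lemma vecMul_Amat (k : ℕ) (v : Fin 3 → ℝ) :
    Matrix.vecMul v (Amat k) = ![v 1, k * v 0 + v 2, (k - 1) * v 0 + v 2] := by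
  ext j
  fin_cases j <;> simp [Amat, Matrix.vecMul, dotProduct, Fin.sum_univ_three] <;> ring

lemma Aprod_succ (k : ℕ → ℕ) (n : ℕ) : Aprod k (n + 1) = Aprod k n * Amat (k (n + 1)) := by
  simp [Aprod, List.range_succ]

lemma vecMul_Aprod_succ (k : ℕ → ℕ) (n : ℕ) (v : Fin 3 → ℝ) :
    Matrix.vecMul v (Aprod k (n + 1)) =
      Matrix.vecMul (Matrix.vecMul v (Aprod k n)) (Amat (k (n + 1))) := by
  rw [Aprod_succ, Matrix.vecMul_vecMul]

lemma exists_int_vecMul_eq (k : ℕ → ℕ) (n : ℕ) (w : Fin 3 → ℤ) :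
    ∃ z : Fin 3 → ℤ, Matrix.vecMul (fun i => (z i : ℝ)) (Aprod k n) = fun i => (w i : ℝ) := by
  induction n generalizing w with
  | zero => exact ⟨w, by simp [Aprod]⟩
  | succ n ih =>
    obtain ⟨z, hz⟩ := ih ![w 1 - w 2, w 0, w 1 - k (n + 1) * (w 1 - w 2)]
    refine ⟨z, ?_⟩
    rw [vecMul_Aprod_succ, hz, vecMul_Amat]
    ext j
    fin_cases j <;> simp
    ring

lemma vecMul_const_Aprod {k : ℕ → ℕ} (hk : ∀ i, 1 ≤ i → 1 ≤ k i) (ξ : ℝ) (n : ℕ) :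
    Matrix.vecMul (fun _ => ξ) (Aprod k n) = fun j => ξ * hgt k n j := by
  induction n with
  | zero => ext j; simp [Aprod, hgt, compApply]
  | succ n ih =>
    rw [vecMul_Aprod_succ, ih, vecMul_Amat]
    have h := hk (n + 1) (by omega)
    ext j
    fin_cases j
    · simp [hgt_succ_zero]
    · simp [hgt_succ_one]; ring
    · simp [hgt_succ_two, Nat.cast_sub h]; ring

lemma abs_sub_round_le (x : ℝ) :
    4 * |x - round x| ≤ ‖Complex.exp (2 * Real.pi * Complex.I * (x : ℂ)) - 1‖ := by
  have h1 : Complex.exp (2 * Real.pi * Complex.I * (x : ℂ)) =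
      Complex.exp (Complex.I * ((2 * Real.pi * (x - round x) : ℝ) : ℂ)) := by
    rw [Complex.exp_eq_exp_iff_exists_int]
    exact ⟨round x, by push_cast; ring⟩
  rw [h1, Complex.norm_exp_I_mul_ofReal_sub_one, norm_mul, Real.norm_eq_abs, Real.norm_eq_abs,
    abs_two, show 2 * Real.pi * (x - round x) / 2 = Real.pi * (x - round x) by ring]
  have h2 := abs_sub_round x
  have h3 : |Real.pi * (x - round x)| ≤ Real.pi / 2 := by
    rw [abs_mul, abs_of_pos Real.pi_pos]
    nlinarith [Real.pi_pos]
  have h4 := Real.mul_abs_le_abs_sin h3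
  rw [abs_mul, abs_of_pos Real.pi_pos, ← mul_assoc, div_mul_cancel₀ _ Real.pi_ne_zero] at h4
  linarith

theorem inStableMod1_of_tendsto {k : ℕ → ℕ} {B N : ℕ} (hg : GoodSeq k B N) {ξ : ℝ}
    (h : ∀ a, Tendsto (fun n => Complex.exp (2 * Real.pi * Complex.I * (ξ : ℂ)) ^ hgt k n a)
      atTop (𝓝 1)) : InStableMod1 k ξ := by
  set w : ℕ → Fin 3 → ℤ := fun n j => round (ξ * hgt k n j) with hw
  set d : ℕ → Fin 3 → ℝ := fun n j => ξ * hgt k n j - w n j with hd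
  have hd0 : ∀ j, Tendsto (fun n => d n j) atTop (𝓝 0) := by
    intro j
    have h1 : Tendsto (fun n => ‖Complex.exp (2 * Real.pi * Complex.I * (ξ : ℂ)) ^ hgt k n j - 1‖)
        atTop (𝓝 0) := by
      rw [← tendsto_zero_iff_norm_tendsto_zero]
      simpa using (h j).sub_const 1
    refine squeeze_zero_norm (fun n => ?_) h1
    have h2 := abs_sub_round_le (ξ * hgt k n j)
    rw [← Complex.exp_nat_mul]
    have h3 : ((hgt k n j : ℂ) * (2 * Real.pi * Complex.I * (ξ : ℂ))) =
        2 * Real.pi * Complex.I * ((ξ * hgt k n j : ℝ) : ℂ) := by push_cast; ring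
    rw [h3, Real.norm_eq_abs]
    linarith [abs_nonneg (ξ * hgt k n j - round (ξ * hgt k n j))]
  have hstep : ∀ᶠ n in atTop, (fun j => (w (n + 1) j : ℝ)) =
      Matrix.vecMul (fun j => (w n j : ℝ)) (Amat (k (n + 1))) := by
    set ε : ℝ := 1 / (B + 3) with hε
    have hε0 : 0 < ε := by positivity
    have hsmall : ∀ᶠ n in atTop, ∀ j, |d n j| < ε := by
      rw [eventually_all]
      intro j
      simpa using (hd0 j).eventually (Metric.ball_mem_nhds 0 hε0)
    filter_upwards [hsmall, (tendsto_add_atTop_nat 1).eventually hsmall] with n h1 h2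
    have hk1 : (1 : ℝ) ≤ k (n + 1) := by exact_mod_cast hg.pos (n + 1) (by omega)
    have hkB : (k (n + 1) : ℝ) ≤ B := by exact_mod_cast hg.le (n + 1) (by omega)
    have hBε : B * ε + 3 * ε = 1 := by rw [hε]; field_simp
    rw [vecMul_Amat]
    have int_eq : ∀ m : ℤ, |(m : ℝ)| < 1 → m = 0 := fun m hm =>
      Int.abs_lt_one_iff.1 (by exact_mod_cast hm)
    have a0 := abs_lt.1 (h1 0)
    have a1 := abs_lt.1 (h1 1)
    have a2 := abs_lt.1 (h1 2)
    have b0 := abs_lt.1 (h2 0)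
    have b1 := abs_lt.1 (h2 1)
    have b2 := abs_lt.1 (h2 2)
    have c0 : |k (n + 1) * d n 0| ≤ B * ε := by
      rw [abs_mul, Nat.abs_cast]
      exact mul_le_mul hkB (h1 0).le (abs_nonneg _) (by positivity)
    have c0' : |((k (n + 1) : ℝ) - 1) * d n 0| ≤ B * ε := by
      rw [abs_mul, abs_of_nonneg (by linarith)]
      exact mul_le_mul (by linarith) (h1 0).le (abs_nonneg _) (by positivity)
    rw [abs_le] at c0 c0'
    have hB0 : 0 ≤ B * ε := by positivity
    ext j
    fin_cases j
    · have e : w (n + 1) 0 - w n 1 = 0 := by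
        refine int_eq _ ?_
        have : ((w (n + 1) 0 - w n 1 : ℤ) : ℝ) = d n 1 - d (n + 1) 0 := by
          simp only [hd, hgt_succ_zero]; push_cast; ring
        rw [this, abs_lt]
        constructor <;> linarith
      simpa using sub_eq_zero.1 e
    · have e : w (n + 1) 1 - (k (n + 1) * w n 0 + w n 2) = 0 := by
        refine int_eq _ ?_
        have : ((w (n + 1) 1 - (k (n + 1) * w n 0 + w n 2) : ℤ) : ℝ) =
            k (n + 1) * d n 0 + d n 2 - d (n + 1) 1 := by
          simp only [hd, hgt_succ_one]; push_cast; ring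
        rw [this, abs_lt]
        constructor <;> linarith
      simp only [sub_eq_zero] at e
      simp [e]
    · have e : w (n + 1) 2 - ((k (n + 1) - 1) * w n 0 + w n 2) = 0 := by
        refine int_eq _ ?_
        have : ((w (n + 1) 2 - ((k (n + 1) - 1) * w n 0 + w n 2) : ℤ) : ℝ) =
            (k (n + 1) - 1) * d n 0 + d n 2 - d (n + 1) 2 := by
          simp only [hd, hgt_succ_two]
          push_cast [Nat.cast_sub (hg.pos (n + 1) (by omega))]
          ring
        rw [this, abs_lt]
        constructor <;> linarith
      simp only [sub_eq_zero] at e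
      simp [e]
  obtain ⟨n₀, hn₀⟩ := eventually_atTop.1 hstep
  obtain ⟨z, hz⟩ := exists_int_vecMul_eq k n₀ (w n₀)
  have hzn : ∀ n ≥ n₀, Matrix.vecMul (fun i => (z i : ℝ)) (Aprod k n) = fun i => (w n i : ℝ) := by
    intro n hn
    induction n, hn using Nat.le_induction with
    | base => exact hz
    | succ n hn ih => rw [vecMul_Aprod_succ, ih, hn₀ n hn]
  refine ⟨z, tendsto_pi_nhds.2 fun j => (hd0 j).congr' ?_⟩
  filter_upwards [eventually_ge_atTop n₀] with n hn
  have : (fun i => ξ - (z i : ℝ)) = (fun _ => ξ) - fun i => (z i : ℝ) := rfl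
  rw [this, Matrix.sub_vecMul, vecMul_const_Aprod hg.pos, hzn n hn]
  rfl

/-- The quadratic Lyapunov functional of the recurrence
`a (n + 3) = a (n + 2) + (1 + e n) * a (n + 1) - a n`. -/
def lyap (a : ℕ → ℝ) (n : ℕ) : ℝ := 2 * a n * (a n - a (n + 2)) - (a n - a (n + 1)) ^ 2

lemma lyap_sub_succ {a e : ℕ → ℝ}
    (ha : ∀ n, a (n + 3) = a (n + 2) + (1 + e n) * a (n + 1) - a n) (n : ℕ) :
    lyap a n - lyap a (n + 1) = (a n - a (n + 2)) ^ 2 + 2 * e n * a (n + 1) ^ 2 := by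
  simp only [lyap, add_assoc, Nat.reduceAdd, ha n]
  ring

lemma lyap_antitone {a e : ℕ → ℝ} (he : ∀ n, 0 ≤ e n)
    (ha : ∀ n, a (n + 3) = a (n + 2) + (1 + e n) * a (n + 1) - a n) : Antitone (lyap a) :=
  antitone_nat_of_succ_le fun n => by
    have := lyap_sub_succ ha n
    have := mul_nonneg (mul_nonneg zero_le_two (he n)) (sq_nonneg (a (n + 1)))
    nlinarith [sq_nonneg (a n - a (n + 2))]

lemma summable_of_le_mul_shift {y : ℕ → ℝ} (hy : ∀ n, 0 ≤ y n) {m : ℕ} {θ : ℝ} (hθ : θ < 1)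
    (h : ∀ n, y (n + m) ≤ θ * y n) : Summable y := by
  refine summable_of_sum_range_le hy (c := (∑ i ∈ Finset.range m, y i) / (1 - θ)) fun T => ?_
  rw [le_div_iff₀ (by linarith)]
  have h1 : ∑ i ∈ Finset.range T, y i ≤ ∑ i ∈ Finset.range (m + T), y i :=
    Finset.sum_le_sum_of_subset_of_nonneg (Finset.range_mono (by omega)) fun i _ _ => hy i
  rw [Finset.sum_range_add] at h1
  have h2 : ∑ i ∈ Finset.range T, y (m + i) ≤ θ * ∑ i ∈ Finset.range T, y i := by
    rw [Finset.mul_sum]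
    exact Finset.sum_le_sum fun i _ => by rw [add_comm]; exact h i
  linarith

theorem summable_abs_of_recurrence {a e : ℕ → ℝ} {N : ℕ} (he : ∀ n, 0 ≤ e n)
    (hgap : ∀ n, ∃ l ≤ N, 1 ≤ e (n + 2 * l + 1))
    (ha : ∀ n, a (n + 3) = a (n + 2) + (1 + e n) * a (n + 1) - a n)
    (h0 : Tendsto a atTop (𝓝 0)) : Summable fun n => |a n| := by
  have hanti := lyap_antitone he ha
  have hV0 : Tendsto (lyap a) atTop (𝓝 0) := by
    have h1 := (tendsto_add_atTop_iff_nat 1).2 h0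
    have h2 := (tendsto_add_atTop_iff_nat 2).2 h0
    have := ((h0.const_mul 2).mul (h0.sub h2)).sub ((h0.sub h1).pow 2)
    change Tendsto (fun n => lyap a n) _ _
    simpa [lyap] using this
  have hVnn : ∀ n, 0 ≤ lyap a n := fun n => hanti.le_of_tendsto hV0 n
  have hdiff : ∀ n i, i < 2 * N + 2 → (a (n + i) - a (n + i + 2)) ^ 2 +
      2 * e (n + i) * a (n + i + 1) ^ 2 ≤ lyap a n - lyap a (n + (2 * N + 2)) := by
    intro n i hi
    rw [← lyap_sub_succ ha]
    have h1 := hanti (show n ≤ n + i by omega)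
    have h2 := hanti (show n + i + 1 ≤ n + (2 * N + 2) by omega)
    linarith
  have hcoef : ∀ n i, 0 ≤ 2 * e (n + i) * a (n + i + 1) ^ 2 := fun n i =>
    mul_nonneg (mul_nonneg zero_le_two (he _)) (sq_nonneg _)
  set D : ℕ → ℝ := fun n => lyap a n - lyap a (n + (2 * N + 2)) with hD
  have hDnn : ∀ n, 0 ≤ D n := fun n => sub_nonneg.2 (hanti (by omega))
  have hstep : ∀ n i, i < 2 * N + 2 → |a (n + i) - a (n + i + 2)| ≤ √(D n) := by
    intro n i hi
    refine Real.abs_le_sqrt ?_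
    linarith [hdiff n i hi, hcoef n i]
  have ha_le : ∀ n, |a n| ≤ (N + 2) * √(D n) := by
    intro n
    obtain ⟨l, hl, hel⟩ := hgap n
    have h1 : |a (n + 2 * (l + 1))| ≤ √(D n) := by
      refine Real.abs_le_sqrt ?_
      have := hdiff n (2 * l + 1) (by omega)
      rw [show n + (2 * l + 1) + 1 = n + 2 * (l + 1) by ring,
        show n + (2 * l + 1) = n + 2 * l + 1 by ring] at this
      nlinarith [sq_nonneg (a (n + 2 * l + 1) - a (n + 2 * l + 1 + 2)),
        sq_nonneg (a (n + 2 * (l + 1)))]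
    have h2 : ∀ j ≤ l + 1, |a n - a (n + 2 * j)| ≤ j * √(D n) := by
      intro j hj
      induction j with
      | zero => simp
      | succ j ih =>
        have h3 := ih (by omega)
        have h4 := hstep n (2 * j) (by omega)
        have h5 := abs_sub_le (a n) (a (n + 2 * j)) (a (n + 2 * (j + 1)))
        rw [show n + 2 * (j + 1) = n + 2 * j + 2 by ring] at h5 ⊢
        push_cast
        linarith
    have h3 := h2 (l + 1) le_rfl
    have h4 := abs_sub_le (a n) (a (n + 2 * (l + 1))) 0
    rw [sub_zero, sub_zero] at h4
    have h5 : ((l + 1 : ℕ) : ℝ) * √(D n) ≤ (N + 1) * √(D n) := by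
      gcongr
      exact_mod_cast Nat.succ_le_succ hl
    linarith
  set K : ℝ := 2 * (N + 2) with hK
  have hK0 : 1 < K := by rw [hK]; have : (0 : ℝ) ≤ N := by positivity
                         linarith
  have hcontr : ∀ n, lyap a (n + (2 * N + 2)) ≤ (1 - 1 / K) * lyap a n := by
    intro n
    have h1 := ha_le n
    have h2 := hstep n 0 (by omega)
    rw [add_zero] at h2
    have h3 : lyap a n ≤ 2 * (|a n| * |a n - a (n + 2)|) := by
      rw [← abs_mul]
      unfold lyap
      nlinarith [le_abs_self (a n * (a n - a (n + 2))), sq_nonneg (a n - a (n + 1))]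
    have h4 : |a n| * |a n - a (n + 2)| ≤ (N + 2) * √(D n) * √(D n) :=
      mul_le_mul h1 h2 (abs_nonneg _) (by positivity)
    rw [mul_assoc, Real.mul_self_sqrt (hDnn n)] at h4
    have h5 : lyap a n ≤ K * (lyap a n - lyap a (n + (2 * N + 2))) := by
      rw [hK]; simp only [hD] at h4; linarith
    rw [← div_le_iff₀' (by linarith)] at h5
    rw [sub_mul, one_mul, one_div, inv_mul_eq_div]
    linarith
  have hsum : Summable fun n => √(lyap a n) := by
    have hθ0 : 0 ≤ 1 - 1 / K := by
      rw [sub_nonneg, div_le_one (by linarith)]; exact hK0.le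
    refine summable_of_le_mul_shift (fun n => Real.sqrt_nonneg _) (m := 2 * N + 2)
      (θ := √(1 - 1 / K)) ?_ fun n => ?_
    · rw [Real.sqrt_lt' one_pos]
      have : 0 < 1 / K := by positivity
      linarith
    · rw [← Real.sqrt_mul hθ0]
      exact Real.sqrt_le_sqrt (hcontr n)
  refine (hsum.mul_left (N + 2 : ℝ)).of_nonneg_of_le (fun n => abs_nonneg _) fun n =>
    (ha_le n).trans ?_
  gcongr
  simp only [hD]
  linarith [hVnn (n + (2 * N + 2))]

theorem summable_of_tendsto_zero {k : ℕ → ℕ} {B N : ℕ} (hg : GoodSeq k B N)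
    {v : ℕ → Fin 3 → ℝ} (hv : ∀ n, v (n + 1) = Matrix.vecMul (v n) (Amat (k (n + 1))))
    (h0 : Tendsto v atTop (𝓝 0)) : Summable fun n => ‖v n‖ := by
  have e1 : ∀ n, v n 1 = v (n + 1) 0 := fun n => by rw [hv n, vecMul_Amat]; rfl
  have e2 : ∀ n, v n 2 = v (n + 2) 0 - k (n + 1) * v n 0 := fun n => by
    have h1 : v (n + 1) 1 = k (n + 1) * v n 0 + v n 2 := by rw [hv n, vecMul_Amat]; rfl
    rw [e1 (n + 1)] at h1
    linarith
  have e3 : ∀ n, v (n + 1) 2 = (k (n + 1) - 1) * v n 0 + v n 2 := fun n => by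
    rw [hv n, vecMul_Amat]; rfl
  have hsum : Summable fun n => |v n 0| := by
    refine summable_abs_of_recurrence (e := fun n => (k (n + 2) : ℝ) - 1) (N := N)
      (fun n => ?_) (fun n => ?_) (fun n => ?_) (tendsto_pi_nhds.1 h0 0)
    · have : (1 : ℝ) ≤ k (n + 2) := by exact_mod_cast hg.pos (n + 2) (by omega)
      linarith
    · obtain ⟨l, hl, h⟩ := hg.gap (n + 3) (by omega)
      refine ⟨l, hl, ?_⟩
      have : (2 : ℝ) ≤ k (n + 3 + 2 * l) := by exact_mod_cast h
      rw [show n + 2 * l + 1 + 2 = n + 3 + 2 * l by ring]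
      linarith
    · have h1 := e3 n
      rw [e2 (n + 1), e2 n] at h1
      have h2 : n + 1 + 2 = n + 3 := rfl
      have h3 : n + 1 + 1 = n + 2 := rfl
      rw [h2, h3] at h1
      linarith
  have s1 := (summable_nat_add_iff 1).2 hsum
  have s2 := (summable_nat_add_iff 2).2 hsum
  refine ((hsum.mul_left (1 + B : ℝ)).add (s1.add s2)).of_nonneg_of_le (fun n => norm_nonneg _)
    fun n => ?_
  have hB : (0 : ℝ) ≤ B := by positivity
  refine (pi_norm_le_iff_of_nonneg (by positivity)).2 fun j => ?_
  rw [Real.norm_eq_abs]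
  have a0 := abs_nonneg (v n 0)
  have a1 := abs_nonneg (v (n + 1) 0)
  have a2 := abs_nonneg (v (n + 2) 0)
  fin_cases j
  · simp only [Fin.zero_eta]
    nlinarith
  · simp only [Fin.mk_one, e1]
    nlinarith
  · simp only [Fin.reduceFinMk, e2]
    have h1 : |(k (n + 1) : ℝ) * v n 0| ≤ B * |v n 0| := by
      rw [abs_mul, Nat.abs_cast]
      gcongr
      exact_mod_cast hg.le (n + 1) (by omega)
    have h2 := abs_sub (v (n + 2) 0) (k (n + 1) * v n 0)
    linarith

lemma exists_cut_le (k : ℕ → ℕ) (c : ℕ → ℕ → Fin 3) (n p : ℕ) :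
    ∃ q, cut k c n q ≤ p ∧ p < cut k c n (q + 1) := by
  induction p with
  | zero =>
    have := cut_strictMono k c n (Nat.zero_lt_one)
    exact ⟨0, by simp, by simpa using this⟩
  | succ p ih =>
    obtain ⟨q, h1, h2⟩ := ih
    rcases (show p + 1 < cut k c n (q + 1) ∨ p + 1 = cut k c n (q + 1) by omega) with h | h
    · exact ⟨q, by omega, h⟩
    · exact ⟨q + 1, h.ge, h ▸ cut_strictMono k c n (Nat.lt_succ_self _)⟩

lemma cut_add_of_agree (k : ℕ → ℕ) (c : ℕ → ℕ → Fin 3) {n q q' j : ℕ}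
    (h : ∀ i < j, c n (q + i) = c n (q' + i)) :
    cut k c n (q + j) + cut k c n q' = cut k c n (q' + j) + cut k c n q := by
  induction j with
  | zero => simp [add_comm]
  | succ j ih =>
    have := ih fun i hi => h i (by omega)
    rw [← add_assoc, ← add_assoc, cut_succ, cut_succ, h j (by omega)]
    omega

lemma compApply_one (k : ℕ → ℕ) (a : Fin 3) : compApply k 1 [a] = chiSub (k 1) a := by
  simp [compApply, applyChi]

lemma IsTower.at_cut_one {k : ℕ → ℕ} {c : ℕ → ℕ → Fin 3} (h : IsTower k c) (q : ℕ) :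
    c 0 (cut k c 1 q) = if c 1 q = 0 then 1 else 2 := by
  have h1 := h.block 1 q (i := 0) (hgt_pos k 1 (c 1 q))
  simp only [add_zero] at h1
  rw [h1]
  generalize c 1 q = a
  fin_cases a <;> simp [compApply, applyChi, chiSub]

lemma IsTower.in_block_one {k : ℕ → ℕ} {c : ℕ → ℕ → Fin 3} (h : IsTower k c) {q i : ℕ}
    (hi0 : 0 < i) (hi : i < hgt k 1 (c 1 q)) : c 0 (cut k c 1 q + i) = 0 := by
  rw [h.block 1 q hi]
  obtain ⟨j, rfl⟩ := Nat.exists_eq_add_of_le' hi0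
  unfold hgt at hi
  revert hi
  generalize c 1 q = a
  fin_cases a <;> simp [compApply, applyChi, chiSub]

lemma IsTower.exists_cut_eq {k : ℕ → ℕ} {c : ℕ → ℕ → Fin 3} (h : IsTower k c) {p : ℕ}
    (hp : c 0 p ≠ 0) : ∃ q, cut k c 1 q = p := by
  obtain ⟨q, h1, h2⟩ := exists_cut_le k c 1 p
  refine ⟨q, ?_⟩
  by_contra hne
  rw [cut_succ] at h2
  obtain ⟨i, rfl⟩ := Nat.exists_eq_add_of_le h1
  exact hp (h.in_block_one (by omega) (by omega))

lemma hgt_one (k : ℕ → ℕ) (a : Fin 3) : hgt k 1 a = ![1, k 1 + 1, k 1 - 1 + 1] a := by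
  rw [hgt, compApply_one]
  fin_cases a <;> simp [chiSub]

lemma GoodSeq.hgt_one_le {k : ℕ → ℕ} {B N : ℕ} (hg : GoodSeq k B N) (a : Fin 3) :
    hgt k 1 a ≤ B + 1 := by
  have := hg.le 1 le_rfl
  rw [hgt_one]
  fin_cases a <;> simp <;> omega

lemma IsTower.letter_eq {k : ℕ → ℕ} {c : ℕ → ℕ → Fin 3} {B N : ℕ} (hg : GoodSeq k B N)
    (h : IsTower k c) {q q' : ℕ}
    (hag : ∀ i < B + 1, c 0 (cut k c 1 q + i) = c 0 (cut k c 1 q' + i)) : c 1 q = c 1 q' := by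
  have hk := hg.pos 1 le_rfl
  have hB := hg.le 1 le_rfl
  have key : ∀ q q', (∀ i < B + 1, c 0 (cut k c 1 q + i) = c 0 (cut k c 1 q' + i)) →
      ¬ (c 1 q = 1 ∧ c 1 q' = 2) := by
    rintro q q' hag ⟨e, e'⟩
    have h1 := hag (k 1) (by omega)
    rw [h.in_block_one (by omega) (by rw [e, hgt_one]; simp)] at h1
    have h2 := cut_succ k c 1 q'
    rw [e', hgt_one] at h2
    have h3 : cut k c 1 q' + k 1 = cut k c 1 (q' + 1) := by
      rw [h2]; simp; omega
    rw [h3, h.at_cut_one] at h1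
    split_ifs at h1
    all_goals simp at h1
  have h0 := hag 0 (by omega)
  rw [add_zero, add_zero, h.at_cut_one, h.at_cut_one] at h0
  have k1 := key q q' hag
  have k2 := key q' q fun i hi => (hag i hi).symm
  revert h0 k1 k2
  generalize c 1 q = a
  generalize c 1 q' = b
  revert a b
  decide

lemma IsTower.sync {k : ℕ → ℕ} {c : ℕ → ℕ → Fin 3} {B N : ℕ} (hg : GoodSeq k B N)
    (h : IsTower k c) {q q' J : ℕ}
    (hag : ∀ i < (B + 1) * J, c 0 (cut k c 1 q + i) = c 0 (cut k c 1 q' + i)) :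
    ∀ j < J, c 1 (q + j) = c 1 (q' + j) := by
  induction J generalizing q q' with
  | zero => intro j hj; omega
  | succ J ih =>
    have h0 : c 1 q = c 1 q' := h.letter_eq hg fun i hi => hag i (by nlinarith)
    have hle := hg.hgt_one_le (c 1 q')
    have h1 := ih (q := q + 1) (q' := q' + 1) fun i hi => by
      rw [cut_succ, cut_succ, h0, add_assoc, add_assoc]
      exact hag _ (by nlinarith)
    intro j hj
    rcases j with _ | j
    · exact h0
    · have := h1 j (by omega)
      rwa [add_assoc, add_assoc, add_comm 1 j] at this

lemma GoodSeq.totalHgt_one_le {k : ℕ → ℕ} {B N : ℕ} (hg : GoodSeq k B N) :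
    totalHgt k 1 ≤ 3 * (B + 1) := by
  rw [totalHgt_eq]
  linarith [hg.hgt_one_le 0, hg.hgt_one_le 1, hg.hgt_one_le 2]

lemma IsTower.recognize_one {k : ℕ → ℕ} {c : ℕ → ℕ → Fin 3} {B N : ℕ} (hg : GoodSeq k B N)
    (h : IsTower k c) {m n J : ℕ}
    (hag : ∀ i < (B + 1) * (J + 4), c 0 (m + i) = c 0 (n + i)) :
    ∃ o q q', o ≤ 3 * (B + 1) ∧ cut k c 1 q = m + o ∧ cut k c 1 q' = n + o ∧
      ∀ j < J, c 1 (q + j) = c 1 (q' + j) := by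
  obtain ⟨q, h1, h2⟩ := exists_cut_ge k c 1 m
  have hT := hg.totalHgt_one_le
  obtain ⟨o, ho⟩ := Nat.exists_eq_add_of_le h1
  have ho' : o ≤ 3 * (B + 1) := by omega
  have hne : c 0 (n + o) ≠ 0 := by
    rw [← hag o (by nlinarith), ← ho, h.at_cut_one]
    split_ifs <;> decide
  obtain ⟨q', hq'⟩ := h.exists_cut_eq hne
  refine ⟨o, q, q', ho', ho, hq', h.sync hg fun i hi => ?_⟩
  rw [ho, hq', add_assoc, add_assoc]
  exact hag _ (by nlinarith)

theorem IsTower.recognize {k : ℕ → ℕ} {c : ℕ → ℕ → Fin 3} {B N : ℕ} (hg : GoodSeq k B N)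
    (h : IsTower k c) (M J : ℕ) :
    ∃ L, ∀ m n, (∀ i < L, c 0 (m + i) = c 0 (n + i)) → ∃ o q q',
      cut k c M q = m + o ∧ cut k c M q' = n + o ∧ ∀ j < J, c M (q + j) = c M (q' + j) := by
  induction M generalizing J with
  | zero =>
    exact ⟨J, fun m n hag => ⟨0, m, n, by simp [cut_zero_left], by simp [cut_zero_left], hag⟩⟩
  | succ M ih =>
    obtain ⟨L, hL⟩ := ih ((B + 1) * (J + 4))
    refine ⟨L, fun m n hag => ?_⟩
    obtain ⟨o, q, q', h1, h2, h3⟩ := hL m n hag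
    obtain ⟨o', r, r', ho', h4, h5, h6⟩ := (h.drop M).recognize_one (hg.dropSeq M) h3
    have h7 := cut_add_of_agree k c (n := M) (q := q) (q' := q') (j := o')
      fun i hi => h3 i (by nlinarith)
    have hle : cut k c M q ≤ cut k c M (q + o') := (cut_strictMono k c M).monotone (by omega)
    refine ⟨o + (cut k c M (q + o') - cut k c M q), r, r', ?_, ?_, h6⟩
    · rw [h.cut_add M 1, h4]; omega
    · rw [h.cut_add M 1, h5]; omega

lemma sum_map_applyChi {k : ℕ} (hk : 1 ≤ k) (v : Fin 3 → ℝ) (w : List (Fin 3)) :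
    ((applyChi k w).map v).sum = (w.map (Matrix.vecMul v (Amat k))).sum := by
  induction w with
  | nil => simp [applyChi]
  | cons a w ih =>
    rw [← List.singleton_append, applyChi_append, List.map_append, List.sum_append, ih,
      List.map_append, List.sum_append, applyChi_singleton]
    congr 1
    rw [vecMul_Amat]
    fin_cases a
    · simp [chiSub]
    · simp [chiSub, add_comm]
    · simp [chiSub, add_comm, Nat.cast_sub hk]

lemma abs_sum_map_le (v : Fin 3 → ℝ) (w : List (Fin 3)) :
    |(w.map v).sum| ≤ w.length * ‖v‖ := by
  induction w with
  | nil => simp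
  | cons a w ih =>
    rw [List.map_cons, List.sum_cons, List.length_cons]
    have h1 := abs_add_le (v a) (w.map v).sum
    have h2 : |v a| ≤ ‖v‖ := norm_le_pi_norm v a
    push_cast
    linarith

lemma IsTower.exists_pre_eq {k : ℕ → ℕ} {c : ℕ → ℕ → Fin 3} {B N : ℕ} (hg : GoodSeq k B N)
    (h : IsTower k c) (n q : ℕ) :
    ∃ r w, r ≤ q ∧ w.length ≤ B + 1 ∧
      pre (c n) q = applyChi (k (n + 1)) (pre (c (n + 1)) r) ++ w := by
  obtain ⟨r, h1, h2⟩ := exists_cut_le (dropSeq k n) (fun i => c (n + i)) 1 q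
  have hr := (cut_strictMono (dropSeq k n) (fun i => c (n + i)) 1).le_apply (x := r)
  rw [cut_succ] at h2
  have h3 := (hg.dropSeq n).hgt_one_le (c (n + 1) r)
  have hlen : (applyChi (k (n + 1)) (pre (c (n + 1)) r)).length =
      cut (dropSeq k n) (fun i => c (n + i)) 1 r := rfl
  have hp := h n r
  obtain ⟨w, hw⟩ : applyChi (k (n + 1)) (pre (c (n + 1)) r) <+: pre (c n) q := by
    rw [isPrefixSeq_iff] at hp
    rw [hp]
    exact pre_isPrefix (isPrefixSeq_pre _ _) (by simpa [hlen] using h1)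
  refine ⟨r, w, hr.trans h1, ?_, hw.symm⟩
  have := congrArg List.length hw
  rw [List.length_append, hlen, length_pre] at this
  omega

lemma IsTower.abs_sum_pre_le {k : ℕ → ℕ} {c : ℕ → ℕ → Fin 3} {B N : ℕ} (hg : GoodSeq k B N)
    (h : IsTower k c) {v : ℕ → Fin 3 → ℝ}
    (hv : ∀ n, v (n + 1) = Matrix.vecMul (v n) (Amat (k (n + 1)))) (m n q : ℕ) :
    |((pre (c n) q).map (v n)).sum| ≤
      (B + 1) * ∑ i ∈ Finset.range m, ‖v (n + i)‖ + q * ‖v (n + m)‖ := by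
  induction m generalizing n q with
  | zero => simpa using abs_sum_map_le (v n) (pre (c n) q)
  | succ m ih =>
    obtain ⟨r, w, hr, hw, heq⟩ := h.exists_pre_eq hg n q
    rw [heq, List.map_append, List.sum_append, sum_map_applyChi (hg.pos _ (by omega)), ← hv,
      Finset.sum_range_succ']
    have h1 := ih (n + 1) r
    have h2 := abs_sum_map_le (v n) w
    have h3 : (w.length : ℝ) * ‖v n‖ ≤ (B + 1) * ‖v n‖ := by
      gcongr
      exact_mod_cast hw
    have h4 : (r : ℝ) * ‖v (n + 1 + m)‖ ≤ q * ‖v (n + 1 + m)‖ := by gcongr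
    have h5 := abs_add_le ((pre (c (n + 1)) r).map (v (n + 1))).sum (w.map (v n)).sum
    simp only [add_assoc, add_comm 1] at h1 h4 ⊢
    simp only [add_zero]
    linarith

lemma IsTower.abs_sum_pre_le_tsum {k : ℕ → ℕ} {c : ℕ → ℕ → Fin 3} {B N : ℕ} (hg : GoodSeq k B N)
    (h : IsTower k c) {v : ℕ → Fin 3 → ℝ}
    (hv : ∀ n, v (n + 1) = Matrix.vecMul (v n) (Amat (k (n + 1))))
    (hs : Summable fun n => ‖v n‖) (n q : ℕ) :
    |((pre (c n) q).map (v n)).sum| ≤ (B + 1) * ∑' i, ‖v (i + n)‖ := by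
  have hs' : Summable fun i => ‖v (i + n)‖ := (summable_nat_add_iff n).2 hs
  have h0 := hs'.tendsto_atTop_zero
  have h1 : Tendsto (fun m => (B + 1) * ∑' i, ‖v (i + n)‖ + q * ‖v (m + n)‖) atTop
      (𝓝 ((B + 1) * ∑' i, ‖v (i + n)‖)) := by
    simpa using (h0.const_mul (q : ℝ)).const_add ((B + 1) * ∑' i, ‖v (i + n)‖)
  refine ge_of_tendsto' h1 fun m => (h.abs_sum_pre_le hg hv m n q).trans ?_
  simp only [add_comm n]
  gcongr
  exact hs'.sum_le_tsum _ fun _ _ => norm_nonneg _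

lemma exists_int_eq_vecMul {k : ℕ → ℕ} (hk : ∀ i, 1 ≤ i → 1 ≤ k i) (ξ : ℝ) (z : Fin 3 → ℤ)
    (n : ℕ) : ∃ t : Fin 3 → ℤ, ∀ j,
      Matrix.vecMul (fun i => ξ - (z i : ℝ)) (Aprod k n) j = ξ * hgt k n j + t j := by
  have : (fun i => ξ - (z i : ℝ)) = (fun _ => ξ) - fun i => (z i : ℝ) := rfl
  rw [this, Matrix.sub_vecMul, vecMul_const_Aprod hk]
  have hz : ∃ t : Fin 3 → ℤ, Matrix.vecMul (fun i => (z i : ℝ)) (Aprod k n) =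
      fun j => (t j : ℝ) := by
    induction n with
    | zero => exact ⟨z, by simp [Aprod]⟩
    | succ n ih =>
      obtain ⟨t, ht⟩ := ih
      refine ⟨![t 1, k (n + 1) * t 0 + t 2, (k (n + 1) - 1) * t 0 + t 2], ?_⟩
      rw [vecMul_Aprod_succ, ht, vecMul_Amat]
      ext j
      fin_cases j <;> simp
  obtain ⟨t, ht⟩ := hz
  refine ⟨-t, fun j => ?_⟩
  simp [ht, sub_eq_add_neg]

lemma exp_pow_cut {k : ℕ → ℕ} (c : ℕ → ℕ → Fin 3) {ξ : ℝ} {n : ℕ} {v : Fin 3 → ℝ}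
    {t : Fin 3 → ℤ} (hv : ∀ j, v j = ξ * hgt k n j + t j) (q : ℕ) :
    Complex.exp (2 * Real.pi * Complex.I * (ξ : ℂ)) ^ cut k c n q =
      Complex.exp (Complex.I * ((2 * Real.pi * ((pre (c n) q).map v).sum : ℝ) : ℂ)) := by
  induction q with
  | zero => simp [pre]
  | succ q ih =>
    rw [cut_succ, pow_add, ih, pre_succ, List.map_append, List.sum_append, ← Complex.exp_nat_mul,
      ← Complex.exp_add, Complex.exp_eq_exp_iff_exists_int]
    refine ⟨-t (c n q), ?_⟩
    simp only [List.map_cons, List.map_nil, List.sum_singleton, hv]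
    push_cast
    ring

theorem exists_agree_pow_close {k : ℕ → ℕ} {c : ℕ → ℕ → Fin 3} {B N : ℕ} (hg : GoodSeq k B N)
    (h : IsTower k c) {ξ : ℝ} (hst : InStableMod1 k ξ) {ε : ℝ} (hε : 0 < ε) :
    ∃ L, ∀ m n, (∀ i < L, c 0 (m + i) = c 0 (n + i)) →
      dist (Complex.exp (2 * Real.pi * Complex.I * (ξ : ℂ)) ^ m)
        (Complex.exp (2 * Real.pi * Complex.I * (ξ : ℂ)) ^ n) ≤ ε := by
  obtain ⟨z, hz⟩ := hst
  set v : ℕ → Fin 3 → ℝ := fun n => Matrix.vecMul (fun i => ξ - (z i : ℝ)) (Aprod k n) with hv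
  have hrec : ∀ n, v (n + 1) = Matrix.vecMul (v n) (Amat (k (n + 1))) := fun n =>
    vecMul_Aprod_succ k n _
  have hs := summable_of_tendsto_zero hg hrec hz
  have htail := tendsto_sum_nat_add fun n => ‖v n‖
  have htail' : Tendsto (fun n => 2 * Real.pi * ((B + 1) * ∑' i, ‖v (i + n)‖)) atTop (𝓝 0) := by
    simpa using (htail.const_mul (B + 1 : ℝ)).const_mul (2 * Real.pi)
  obtain ⟨M, hM⟩ := (htail'.eventually_lt_const (half_pos hε)).exists
  obtain ⟨L, hL⟩ := h.recognize hg M 0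
  obtain ⟨t, ht⟩ := exists_int_eq_vecMul hg.pos ξ z M
  set e := Complex.exp (2 * Real.pi * Complex.I * (ξ : ℂ)) with he
  have hclose : ∀ q, ‖e ^ cut k c M q - 1‖ ≤ ε / 2 := fun q => by
    rw [exp_pow_cut c ht q]
    refine (Real.norm_exp_I_mul_ofReal_sub_one_le).trans ?_
    rw [Real.norm_eq_abs, abs_mul, abs_of_pos (by positivity)]
    refine le_trans ?_ hM.le
    gcongr
    exact h.abs_sum_pre_le_tsum hg hrec hs M q
  have he1 : ‖e‖ = 1 := by
    rw [he, show 2 * Real.pi * Complex.I * (ξ : ℂ) = ((2 * Real.pi * ξ : ℝ) : ℂ) * Complex.I by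
      push_cast; ring, Complex.norm_exp_ofReal_mul_I]
  refine ⟨L, fun m n hag => ?_⟩
  obtain ⟨o, q, q', h1, h2, -⟩ := hL m n hag
  have c1 := hclose q
  have c2 := hclose q'
  rw [h1] at c1
  rw [h2] at c2
  have h3 : dist (e ^ m) (e ^ n) = ‖(e ^ (m + o) - 1) - (e ^ (n + o) - 1)‖ := by
    rw [dist_eq_norm, show (e ^ (m + o) - 1) - (e ^ (n + o) - 1) = (e ^ m - e ^ n) * e ^ o by ring,
      norm_mul, norm_pow, he1]
    simp
  rw [h3]
  exact (norm_sub_le _ _).trans (by linarith)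

/-- A function defined along the orbit of `ρ` by powers of `z` extends continuously to the orbit
closure as an eigenfunction of modulus one. -/
theorem exists_continuous_eigen {ρ : ℕ → Fin 3} {z : ℂ} (hz : ‖z‖ = 1)
    (hclose : ∀ ε > 0, ∃ L, ∀ m n, (∀ i < L, ρ (m + i) = ρ (n + i)) →
      dist (z ^ m) (z ^ n) ≤ ε) :
    ∃ f : (ℕ → Fin 3) → ℂ, ContinuousOn f (orbitClosure ρ) ∧
      (∀ x ∈ orbitClosure ρ, ‖f x‖ = 1) ∧ ∀ x ∈ orbitClosure ρ, f (shift x) = z * f x := by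
  classical
  set A := Set.range (orb ρ) with hA
  have hX : orbitClosure ρ = closure A := orbitClosure_eq ρ
  rw [hX]
  let f₀ : (ℕ → Fin 3) → ℂ := fun x => if h : ∃ n, orb ρ n = x then z ^ h.choose else 0
  have hf₀ : ∀ n, f₀ (orb ρ n) = z ^ n := by
    intro n
    have hex : ∃ m, orb ρ m = orb ρ n := ⟨n, rfl⟩
    simp only [f₀, dif_pos hex]
    refine eq_of_forall_dist_le fun ε hε => ?_
    obtain ⟨L, hL⟩ := hclose ε hε
    refine hL _ _ fun i _ => ?_
    have := congrFun hex.choose_spec i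
    simpa [orb, add_comm] using this
  have hlim : ∀ x ∈ closure A, ∃ y, Tendsto f₀ (𝓝[A] x) (𝓝 y) := by
    intro x hx
    have hne : (𝓝[A] x).NeBot := mem_closure_iff_nhdsWithin_neBot.1 hx
    rw [← cauchy_map_iff_exists_tendsto, Metric.cauchy_iff]
    refine ⟨inferInstance, fun ε hε => ?_⟩
    obtain ⟨L, hL⟩ := hclose (ε / 2) (half_pos hε)
    refine ⟨f₀ '' (PiNat.cylinder x L ∩ A), image_mem_map (inter_mem
      (mem_nhdsWithin_of_mem_nhds ?_) self_mem_nhdsWithin), ?_⟩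
    · exact (PiNat.isOpen_cylinder _ x L).mem_nhds (PiNat.self_mem_cylinder x _)
    · rintro _ ⟨_, ⟨h1, m, rfl⟩, rfl⟩ _ ⟨_, ⟨h2, n, rfl⟩, rfl⟩
      rw [hf₀, hf₀]
      refine (hL m n fun i hi => ?_).trans_lt (by linarith)
      have a := h1 i hi
      have b := h2 i hi
      simp only [orb] at a b
      rw [add_comm m, add_comm n, a, b]
  set f := extendFrom A f₀ with hf
  have hcont : ContinuousOn f (closure A) := continuousOn_extendFrom subset_rfl hlim
  have hforb : ∀ n, f (orb ρ n) = z ^ n := by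
    intro n
    have hmem : orb ρ n ∈ A := ⟨n, rfl⟩
    obtain ⟨y, hy⟩ := hlim _ (subset_closure hmem)
    rw [hf, extendFrom_eq (subset_closure hmem) hy, ← hf₀]
    exact tendsto_nhds_unique (hy.mono_left (pure_le_nhdsWithin hmem)) (tendsto_pure_nhds f₀ _)
  have hsA : Set.MapsTo shift A A := by
    rintro _ ⟨n, rfl⟩
    exact ⟨n + 1, (shift_orb ρ n).symm⟩
  have hsX : Set.MapsTo shift (closure A) (closure A) := hsA.closure continuous_shift
  refine ⟨f, hcont, fun x hx => ?_, fun x hx => ?_⟩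
  · have hne : (𝓝[A] x).NeBot := mem_closure_iff_nhdsWithin_neBot.1 hx
    have h1 : Tendsto f (𝓝[A] x) (𝓝 (f x)) := (hcont x hx).mono subset_closure
    refine tendsto_nhds_unique h1.norm (tendsto_const_nhds.congr' ?_)
    filter_upwards [self_mem_nhdsWithin] with y hy
    obtain ⟨n, rfl⟩ := hy
    rw [hforb, norm_pow, hz, one_pow]
  · have hne : (𝓝[A] x).NeBot := mem_closure_iff_nhdsWithin_neBot.1 hx
    have h1 : Tendsto f (𝓝[A] x) (𝓝 (f x)) := (hcont x hx).mono subset_closure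
    have h2 : Tendsto (fun y => f (shift y)) (𝓝[A] x) (𝓝 (f (shift x))) :=
      ((hcont.comp continuous_shift.continuousOn hsX) x hx).mono subset_closure
    refine tendsto_nhds_unique h2 ((h1.const_mul z).congr' ?_)
    filter_upwards [self_mem_nhdsWithin] with y hy
    obtain ⟨n, rfl⟩ := hy
    rw [shift_orb, hforb, hforb, pow_succ']

lemma goodSeq_of_gaps {k : ℕ → ℕ} {B N : ℕ} (hpos : ∀ i, 1 ≤ i → 1 ≤ k i)
    (hB : ∀ i, 1 ≤ i → k i ≤ B)
    (hN : ∀ i, 1 ≤ i → (∃ j, i ≤ j ∧ j ≤ i + N ∧ 1 < k (2 * j)) ∧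
      (∃ j', i ≤ j' ∧ j' ≤ i + N ∧ 1 < k (2 * j' - 1))) : GoodSeq k B N where
  pos := hpos
  le := hB
  gap i hi := by
    rcases Nat.even_or_odd' i with ⟨m, rfl | rfl⟩
    · obtain ⟨j, h1, h2, h3⟩ := (hN m (by omega)).1
      exact ⟨j - m, by omega, by rwa [show 2 * m + 2 * (j - m) = 2 * j by omega]⟩
    · obtain ⟨j, h1, h2, h3⟩ := (hN (m + 1) (by omega)).2
      exact ⟨j - (m + 1), by omega,
        by rwa [show 2 * m + 1 + 2 * (j - (m + 1)) = 2 * j - 1 by omega]⟩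

lemma norm_exp_two_pi_I (ξ : ℝ) : ‖Complex.exp (2 * Real.pi * Complex.I * (ξ : ℂ))‖ = 1 := by
  rw [show 2 * Real.pi * Complex.I * (ξ : ℂ) = ((2 * Real.pi * ξ : ℝ) : ℂ) * Complex.I by
    push_cast; ring, Complex.norm_exp_ofReal_mul_I]

lemma exp_two_pi_I_ne_one {ξ : ℝ} (hξ : ξ ∈ Set.Ioo (0 : ℝ) 1) :
    Complex.exp (2 * Real.pi * Complex.I * (ξ : ℂ)) ≠ 1 := by
  intro h
  obtain ⟨n, hn⟩ := Complex.exp_eq_one_iff.1 h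
  have h2 : (ξ : ℂ) = n := by
    have : (2 * Real.pi * Complex.I : ℂ) ≠ 0 := Complex.two_pi_I_ne_zero
    refine mul_left_cancel₀ this (hn.trans (mul_comm _ _))
  have h3 : ξ = n := by exact_mod_cast h2
  obtain ⟨h4, h5⟩ := hξ
  rw [h3] at h4 h5
  have h6 : (0 : ℤ) < n := by exact_mod_cast h4
  have h7 : n < (1 : ℤ) := by exact_mod_cast h5
  omega

lemma exists_eq_exp_two_pi_I {z : ℂ} (hz : ‖z‖ = 1) :
    ∃ ξ ∈ Set.Ico (0 : ℝ) 1, z = Complex.exp (2 * Real.pi * Complex.I * (ξ : ℂ)) := by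
  obtain ⟨θ, rfl⟩ := (Complex.norm_eq_one_iff z).1 hz
  refine ⟨Int.fract (θ / (2 * Real.pi)), ⟨Int.fract_nonneg _, Int.fract_lt_one _⟩, ?_⟩
  rw [Complex.exp_eq_exp_iff_exists_int]
  refine ⟨⌊θ / (2 * Real.pi)⌋, ?_⟩
  rw [← Int.self_sub_floor]
  have : (Real.pi : ℂ) ≠ 0 := by exact_mod_cast Real.pi_ne_zero
  push_cast
  field_simp
  ring

/-- A continuous eigenfunction for every `ξ` in the stable space modulo one. -/
lemma exists_eigen_of_inStableMod1 {k : ℕ → ℕ} {c : ℕ → ℕ → Fin 3} {B N : ℕ} (hg : GoodSeq k B N)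
    (h : IsTower k c) {ξ : ℝ} (hst : InStableMod1 k ξ) :
    ∃ f : (ℕ → Fin 3) → ℂ, ContinuousOn f (orbitClosure (c 0)) ∧
      (∀ x ∈ orbitClosure (c 0), ‖f x‖ = 1) ∧ ∀ x ∈ orbitClosure (c 0),
        f (shift x) = Complex.exp (2 * Real.pi * Complex.I * (ξ : ℂ)) * f x :=
  exists_continuous_eigen (norm_exp_two_pi_I ξ) fun _ hε => exists_agree_pow_close hg h hst hε

lemma IsInvProb.aemeasurable_of_continuousOn {X : Set (ℕ → Fin 3)} (hX : IsClosed X)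
    {μ : Measure (ℕ → Fin 3)} (hμ : IsInvProb X μ) {f : (ℕ → Fin 3) → ℂ}
    (hf : ContinuousOn f X) : AEMeasurable f μ := by
  have h1 : X =ᵐ[μ] Set.univ := ae_eq_univ.2 hμ.2.1
  have h2 := hf.aemeasurable (μ := μ) hX.measurableSet
  rwa [Measure.restrict_congr_set h1, Measure.restrict_univ] at h2

lemma IsInvProb.not_weaklyMixing {k : ℕ → ℕ} {c : ℕ → ℕ → Fin 3} {B N : ℕ} (hg : GoodSeq k B N)
    (h : IsTower k c) {μ : Measure (ℕ → Fin 3)} (hμ : IsInvProb (orbitClosure (c 0)) μ) {ξ : ℝ}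
    (hξ : ξ ∈ Set.Ioo (0 : ℝ) 1) (hst : InStableMod1 k ξ) : ¬ WeaklyMixing μ := by
  intro hwm
  have := hμ.1
  obtain ⟨f, hfc, hf1, hfs⟩ := exists_eigen_of_inStableMod1 hg h hst
  have hX : ∀ᵐ x ∂μ, x ∈ orbitClosure (c 0) := by
    rw [ae_iff]; exact hμ.2.1
  have hfm := hμ.aemeasurable_of_continuousOn (isClosed_orbitClosure _) hfc
  have hne : ¬ f =ᵐ[μ] 0 := fun h0 => by
    obtain ⟨x, hx, hx'⟩ := (hX.and h0).exists
    have := hf1 x hx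
    rw [hx'] at this
    simp at this
  obtain ⟨d, hd⟩ := hwm f _ hfm hne (hX.mono hfs)
  obtain ⟨x, hx, h1, h2⟩ := (hX.and
    (hd.and (hμ.measurePreserving.quasiMeasurePreserving.ae hd))).exists
  have h3 := hfs x hx
  rw [h2, h1] at h3
  have hd0 : d ≠ 0 := by
    rintro rfl
    have := hf1 x hx
    rw [h1] at this
    simp at this
  exact exp_two_pi_I_ne_one hξ (mul_right_cancel₀ hd0 (h3.symm.trans (one_mul d).symm))

/-- for a bounded sequence `(k_i)` of positive integers satisfying (★)
whose sets `{i : k_{2i} > 1}`, `{i : k_{2i-1} > 1}` have bounded gaps, the subshift is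
uniquely ergodic, and for its unique invariant measure `μ`:
(a) `(X,σ,μ)` is weakly mixing iff for every `ξ ∈ (0,1)` the vector `(ξ,ξ,ξ)` is not
in the stable space `W^s(0) mod 1`;
(b) every measurable eigenvalue `e^{2πiξ}`, `ξ ∈ (0,1)`, is a continuous eigenvalue. -/
theorem statement17 (k : ℕ → ℕ) (hpos : ∀ i, 1 ≤ i → 1 ≤ k i) (hstar : StarCond k)
    (hbdd : ∃ B : ℕ, ∀ i, 1 ≤ i → k i ≤ B)
    (hgaps : ∃ N : ℕ, ∀ i, 1 ≤ i →
      (∃ j, i ≤ j ∧ j ≤ i + N ∧ 1 < k (2 * j)) ∧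
      (∃ j', i ≤ j' ∧ j' ≤ i + N ∧ 1 < k (2 * j' - 1)))
    (ρ : ℕ → Fin 3) (hρ : ∀ n : ℕ, IsPrefixSeq (compApply k n [2]) ρ) :
    (∃! μ : Measure (ℕ → Fin 3), IsInvProb (orbitClosure ρ) μ) ∧
    ∀ μ : Measure (ℕ → Fin 3), IsInvProb (orbitClosure ρ) μ →
      (WeaklyMixing μ ↔ ∀ ξ ∈ Set.Ioo (0 : ℝ) 1, ¬ InStableMod1 k ξ) ∧
      (∀ ξ ∈ Set.Ioo (0 : ℝ) 1,
        (∃ f : (ℕ → Fin 3) → ℂ, AEMeasurable f μ ∧ ¬ f =ᵐ[μ] 0 ∧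
          (fun x => f (shift x)) =ᵐ[μ]
            (fun x => Complex.exp (2 * Real.pi * Complex.I * (ξ : ℂ)) * f x)) →
        IsCtsEigenvalue (orbitClosure ρ)
          (Complex.exp (2 * Real.pi * Complex.I * (ξ : ℂ)))) := by
  obtain ⟨B, hB⟩ := hbdd
  obtain ⟨N, hN⟩ := hgaps
  have hg : GoodSeq k B N := goodSeq_of_gaps hpos hB hN
  obtain ⟨c, ht, rfl⟩ := exists_tower hg hρ
  have hmeas : ∀ μ, IsInvProb (orbitClosure (c 0)) μ → ∀ (f : (ℕ → Fin 3) → ℂ) (ξ : ℝ),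
      AEMeasurable f μ → ¬ f =ᵐ[μ] 0 →
      ((fun x => f (shift x)) =ᵐ[μ]
        fun x => Complex.exp (2 * Real.pi * Complex.I * (ξ : ℂ)) * f x) → InStableMod1 k ξ :=
    fun μ hμ f ξ hf hf0 hfz => inStableMod1_of_tendsto hg (eigen_pow_hgt hg ht hμ hf hf0 hfz)
  refine ⟨?_, fun μ hμ => ⟨⟨fun hwm ξ hξ hst => hμ.not_weaklyMixing hg ht hξ hst hwm, ?_⟩, ?_⟩⟩
  · obtain ⟨μ, hμ⟩ := exists_isInvProb (c 0)
    exact ⟨μ, hμ, fun ν hν => hν.eq hg ht hμ⟩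
  · intro hno f z hf hf0 hfz
    have he := hμ.ergodic hg ht
    obtain ⟨ξ, ⟨hξ0, hξ1⟩, rfl⟩ := exists_eq_exp_two_pi_I (eigen_norm hμ he hf hf0 hfz).1
    rcases hξ0.eq_or_lt with rfl | hξ
    · have hinv : (fun x => f (shift x)) =ᵐ[μ] fun x => f x := by simpa using hfz
      exact he.ae_eq_const_of_ae_eq_comp_ae hf.aestronglyMeasurable hinv
    · exact absurd (hmeas μ hμ f ξ hf hf0 hfz) (hno ξ ⟨hξ, hξ1⟩)
  · rintro ξ - ⟨f, hf, hf0, hfz⟩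
    obtain ⟨F, hF, hF1, hFs⟩ := exists_eigen_of_inStableMod1 hg ht (hmeas μ hμ f ξ hf hf0 hfz)
    refine ⟨F, hF, ⟨orb (c 0) 0, orb_mem_orbitClosure _ _, fun h0 => ?_⟩, hFs⟩
    simpa [h0] using hF1 _ (orb_mem_orbitClosure (c 0) 0)
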